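/- arXiv:1806.08510 — 3 statements merged into one kernel-verified Lean document; each statement's English description precedes it below -/
import Mathlib

section
/- Let a, b > 0, let Q(x) = 3^{1/4}(1+|x|^2)^{-1/2}, let k = ∫_{ℝ³}|∇Q|² dx, and set √c = (1/2)(b·k + √(b²k² + 4a)). Then for every λ > 0 and every x₀ ∈ ℝ³, the function u(x) = λ^{-1/2} Q((x/√c - x₀)/λ) is a positive C² function with ∫_{ℝ³}|∇u|² dx < ∞ satisfying -(a + b∫_{ℝ³}|∇u|² dx) Δu(x) = u(x)⁵ for every x ∈ ℝ³. -/
open MeasureTheory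
open scoped RealInnerProductSpace

noncomputable section

/-- Euclidean space `ℝ³`. -/
abbrev R3 : Type := EuclideanSpace ℝ (Fin 3)

/-- The Laplacian `Δu = ∑ᵢ ∂²u/∂xᵢ²` on `ℝ³`. -/
noncomputable def lap (u : R3 → ℝ) (x : R3) : ℝ :=
  ∑ i : Fin 3,
    fderiv ℝ (fun y => fderiv ℝ u y (EuclideanSpace.single i 1)) x (EuclideanSpace.single i 1)

/-- The Aubin–Talenti bubble `Q(x) = 3^(1/4) (1 + |x|²)^(-1/2)` on `ℝ³`. -/
noncomputable def Qb (x : R3) : ℝ := (3 : ℝ) ^ ((1 : ℝ) / 4) * (1 + ‖x‖ ^ 2) ^ (-(1 : ℝ) / 2)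

/-- The affine rescaling `A (1 + |μ x - w|²)^(-1/2)` of the bubble profile. -/
def bubble (A μ : ℝ) (w x : R3) : ℝ := A * (1 + ‖μ • x - w‖ ^ 2) ^ (-(1 : ℝ) / 2)

lemma hasFDerivAt_norm_sq_affine (μ : ℝ) (w x : R3) :
    HasFDerivAt (fun y : R3 => 1 + ‖μ • y - w‖ ^ 2) ((2 * μ) • innerSL ℝ (μ • x - w)) x := by
  have h : HasFDerivAt (fun y : R3 => μ • y - w) (μ • ContinuousLinearMap.id ℝ R3) x :=
    ((hasFDerivAt_id x).const_smul μ).sub_const w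
  refine (h.norm_sq.const_add 1).congr_fderiv ?_
  ext v
  simp
  ring

lemma hasFDerivAt_rpow_norm_sq_affine (μ r : ℝ) (w x : R3) :
    HasFDerivAt (fun y : R3 => (1 + ‖μ • y - w‖ ^ 2) ^ r)
      ((2 * μ * r * (1 + ‖μ • x - w‖ ^ 2) ^ (r - 1)) • innerSL ℝ (μ • x - w)) x := by
  have hs : 0 < 1 + ‖μ • x - w‖ ^ 2 := by positivity
  refine ((hasFDerivAt_norm_sq_affine μ w x).rpow_const (Or.inl hs.ne')).congr_fderiv ?_
  rw [smul_smul]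
  congr 1
  ring

lemma hasFDerivAt_bubble (A μ : ℝ) (w x : R3) :
    HasFDerivAt (bubble A μ w)
      ((-(A * μ * (1 + ‖μ • x - w‖ ^ 2) ^ (-(3 : ℝ) / 2))) • innerSL ℝ (μ • x - w)) x := by
  refine ((hasFDerivAt_rpow_norm_sq_affine μ (-1 / 2) w x).const_mul A).congr_fderiv ?_
  rw [smul_smul, show (-(1 : ℝ) / 2 - 1) = -3 / 2 by norm_num]
  congr 1
  ring

lemma contDiff_bubble (A μ : ℝ) (w : R3) : ContDiff ℝ 2 (bubble A μ w) := by
  have h : ContDiff ℝ 2 fun x : R3 => 1 + ‖μ • x - w‖ ^ 2 :=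
    contDiff_const.add (((contDiff_const_smul μ).sub contDiff_const).norm_sq ℝ)
  exact contDiff_const.mul (h.rpow_const_of_ne fun x => by positivity)

lemma norm_gradient_bubble_sq (A μ : ℝ) (w x : R3) :
    ‖gradient (bubble A μ w) x‖ ^ 2 =
      A ^ 2 * μ ^ 2 * ((1 + ‖μ • x - w‖ ^ 2) ^ (-(3 : ℝ) / 2)) ^ 2 * ‖μ • x - w‖ ^ 2 := by
  rw [gradient, LinearIsometryEquiv.norm_map, (hasFDerivAt_bubble A μ w x).fderiv, norm_smul,
    innerSL_apply_norm, mul_pow, Real.norm_eq_abs, sq_abs]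
  ring

lemma lap_bubble (A μ : ℝ) (w x : R3) :
    lap (bubble A μ w) x = -(3 * A * μ ^ 2 * (1 + ‖μ • x - w‖ ^ 2) ^ (-(5 : ℝ) / 2)) := by
  have hfirst (i : Fin 3) : (fun y => fderiv ℝ (bubble A μ w) y (EuclideanSpace.single i 1)) =
      fun y : R3 => -(A * μ) * ((1 + ‖μ • y - w‖ ^ 2) ^ (-(3 : ℝ) / 2) * (μ * y i - w i)) := by
    funext y
    rw [(hasFDerivAt_bubble A μ w y).fderiv]
    simp [EuclideanSpace.inner_single_right]
    ring
  have hcoord (i : Fin 3) : HasFDerivAt (fun y : R3 => μ * y i - w i)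
      (μ • (EuclideanSpace.proj i : R3 →L[ℝ] ℝ)) x :=
    ((EuclideanSpace.proj i : R3 →L[ℝ] ℝ).hasFDerivAt.const_mul μ).sub_const (w i)
  have hsecond (i : Fin 3) :
      fderiv ℝ (fun y => fderiv ℝ (bubble A μ w) y (EuclideanSpace.single i 1)) x
        (EuclideanSpace.single i 1) =
      -(A * μ ^ 2) * ((1 + ‖μ • x - w‖ ^ 2) ^ (-(3 : ℝ) / 2)
        - 3 * (1 + ‖μ • x - w‖ ^ 2) ^ (-(5 : ℝ) / 2) * (μ * x i - w i) ^ 2) := by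
    rw [hfirst, (((hasFDerivAt_rpow_norm_sq_affine μ (-3 / 2) w x).fun_mul
      (hcoord i)).const_mul (-(A * μ))).fderiv, show (-(3 : ℝ) / 2 - 1) = -5 / 2 by norm_num]
    simp [EuclideanSpace.inner_single_right]
    ring
  have hnorm : ‖μ • x - w‖ ^ 2 = ∑ i : Fin 3, (μ * x i - w i) ^ 2 := by
    simp [EuclideanSpace.norm_sq_eq]
  have hpow : (1 + ‖μ • x - w‖ ^ 2) ^ (-(3 : ℝ) / 2) =
      (1 + ‖μ • x - w‖ ^ 2) ^ (-(5 : ℝ) / 2) * (1 + ‖μ • x - w‖ ^ 2) := by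
    rw [← Real.rpow_add_one (by positivity)]
    norm_num
  simp only [lap, hsecond, hpow, Fin.sum_univ_three] at hnorm ⊢
  linear_combination (-3 * A * μ ^ 2 * (1 + ‖μ • x - w‖ ^ 2) ^ (-(5 : ℝ) / 2)) * hnorm

lemma Qb_eq_bubble : Qb = bubble ((3 : ℝ) ^ ((1 : ℝ) / 4)) 1 0 := by
  funext x
  simp [Qb, bubble]

lemma integrable_norm_gradient_Qb_sq : Integrable fun x : R3 => ‖gradient Qb x‖ ^ 2 := by
  have hdom : Integrable fun x : R3 => (1 + ‖x‖ ^ 2) ^ (-(4 : ℝ) / 2) :=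
    integrable_rpow_neg_one_add_norm_sq (by simp; norm_num)
  simp only [Qb_eq_bubble, norm_gradient_bubble_sq, one_smul, sub_zero]
  refine (hdom.const_mul (((3 : ℝ) ^ ((1 : ℝ) / 4)) ^ 2)).mono' ?_ (.of_forall fun x => ?_)
  · refine Continuous.aestronglyMeasurable ?_
    have h : Continuous fun x : R3 => (1 + ‖x‖ ^ 2) ^ (-(3 : ℝ) / 2) :=
      (by fun_prop : Continuous fun x : R3 => 1 + ‖x‖ ^ 2).rpow_const
        fun x => Or.inl (by positivity)
    fun_prop
  · have hs : 0 < 1 + ‖x‖ ^ 2 := by positivity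
    have hpow : ((1 + ‖x‖ ^ 2) ^ (-(3 : ℝ) / 2)) ^ 2 * (1 + ‖x‖ ^ 2) =
        (1 + ‖x‖ ^ 2) ^ (-(4 : ℝ) / 2) := by
      rw [← Real.rpow_mul_natCast hs.le, ← Real.rpow_add_one hs.ne']
      norm_num
    rw [Real.norm_of_nonneg (by positivity), ← hpow, one_pow, mul_one, mul_assoc]
    gcongr
    linarith

/-- with `√c = (bk + √(b²k² + 4a))/2`, `k = ∫|∇Q|²`, each function
`u(x) = λ^(-1/2) Q((x/√c - x₀)/λ)` with `λ > 0`, `x₀ ∈ ℝ³` is a positive, `C²`,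
finite-energy solution of the Kirchhoff equation `-(a + b∫|∇u|²)Δu = u⁵` on `ℝ³`. -/
theorem rescaled_bubble_solves_kirchhoff (a b : ℝ) (ha : 0 < a) (hb : 0 < b)
    (k : ℝ) (hk : k = ∫ x : R3, ‖gradient Qb x‖ ^ 2)
    (sc : ℝ) (hsc : sc = (b * k + Real.sqrt (b ^ 2 * k ^ 2 + 4 * a)) / 2)
    (l : ℝ) (hl : 0 < l) (x₀ : R3) (u : R3 → ℝ)
    (hu : ∀ x, u x = l ^ (-(1 : ℝ) / 2) * Qb (l⁻¹ • (sc⁻¹ • x - x₀))) :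
    (∀ x, 0 < u x) ∧ ContDiff ℝ 2 u ∧
    Integrable (fun x : R3 => ‖gradient u x‖ ^ 2) ∧
    (∀ x, -((a + b * ∫ y : R3, ‖gradient u y‖ ^ 2) * lap u x) = u x ^ 5) := by
  have hdisc : 0 < b ^ 2 * k ^ 2 + 4 * a := by positivity
  have hk0 : 0 ≤ k := hk ▸ integral_nonneg fun x => by positivity
  have hscpos : 0 < sc := hsc ▸ by positivity
  have hquad : a + b * (sc * k) = sc ^ 2 := by
    rw [hsc]
    linear_combination (-1 / 4 : ℝ) * Real.sq_sqrt hdisc.le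
  set C : ℝ := (3 : ℝ) ^ ((1 : ℝ) / 4) with hC
  set L : ℝ := l ^ (-(1 : ℝ) / 2) with hL
  have hCpos : 0 < C := by positivity
  have hLpos : 0 < L := by positivity
  have hC4 : C ^ 4 = 3 := by
    rw [hC, ← Real.rpow_mul_natCast (by norm_num)]
    norm_num
  have hL2 : L ^ 2 = l⁻¹ := by
    rw [hL, ← Real.rpow_mul_natCast hl.le, ← Real.rpow_neg_one]
    norm_num
  have hub : u = bubble (L * C) (l⁻¹ * sc⁻¹) (l⁻¹ • x₀) := by
    funext x
    rw [hu, Qb, bubble, smul_sub, smul_smul, mul_assoc]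
  have hgrad (x : R3) : ‖gradient u x‖ ^ 2 = (L * (l⁻¹ * sc⁻¹)) ^ 2 *
      ‖gradient Qb ((l⁻¹ * sc⁻¹) • x - l⁻¹ • x₀)‖ ^ 2 := by
    simp only [hub, Qb_eq_bubble, norm_gradient_bubble_sq, one_smul, sub_zero, ← hC]
    ring
  have hμ : 0 < l⁻¹ * sc⁻¹ := by positivity
  have hint : Integrable fun x : R3 => ‖gradient u x‖ ^ 2 := by
    simp only [hgrad]
    exact ((integrable_norm_gradient_Qb_sq.comp_sub_right (l⁻¹ • x₀)).comp_smul
      hμ.ne').const_mul _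
  have henergy : ∫ x : R3, ‖gradient u x‖ ^ 2 = sc * k := by
    simp only [hgrad]
    rw [integral_const_mul, Measure.integral_comp_smul volume
      (fun y : R3 => ‖gradient Qb (y - l⁻¹ • x₀)‖ ^ 2),
      integral_sub_right_eq_self (fun y : R3 => ‖gradient Qb y‖ ^ 2), ← hk,
      finrank_euclideanSpace_fin, abs_of_pos (by positivity), smul_eq_mul, mul_pow, hL2]
    field_simp
  refine ⟨fun x => ?_, hub ▸ contDiff_bubble _ _ _, hint, fun x => ?_⟩
  · rw [hub, bubble]
    positivity
  · rw [henergy, hquad, hub, lap_bubble, bubble]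
    set s : ℝ := 1 + ‖(l⁻¹ * sc⁻¹) • x - l⁻¹ • x₀‖ ^ 2 with hs
    have hspos : 0 < s := by positivity
    have hpow : (s ^ (-(1 : ℝ) / 2)) ^ 5 = s ^ (-(5 : ℝ) / 2) := by
      rw [← Real.rpow_mul_natCast hspos.le]
      norm_num
    rw [mul_pow (L * C), hpow, show (L * C) ^ 5 = (L ^ 2) ^ 2 * C ^ 4 * (L * C) by ring, hL2, hC4]
    field_simp
end
end

section
/- Let a, b > 0 and let u : ℝ³ → ℝ be a positive C² function with ∫_{ℝ³}|∇u|² dx < ∞ satisfying the Kirchhoff equation -(a + b∫_{ℝ³}|∇u|² dx) Δu(x) = u(x)⁵ for every x ∈ ℝ³. Then there exist λ > 0 and x₀ ∈ ℝ³ such that u(x) = λ^{-1/2} Q((x/√c - x₀)/λ) for all x ∈ ℝ³, where Q(x) = 3^{1/4}(1+|x|^2)^{-1/2}, k = ∫_{ℝ³}|∇Q|² dx, and √c = (1/2)(b·k + √(b²k² + 4a)). In particular, the positive solution of the Kirchhoff equation is unique up to translations and scalings. -/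
open MeasureTheory
open scoped RealInnerProductSpace

noncomputable section

open Filter Topology Set

lemma hasDerivAt_line (x e : R3) (t : ℝ) : HasDerivAt (fun s : ℝ => x + s • e) e t := by
  simpa using ((hasDerivAt_id t).smul_const e).const_add x

lemma differentiableAt_fderiv_apply {f : R3 → ℝ} {x : R3} (hf : ContDiffAt ℝ 2 f x) (e : R3) :
    DifferentiableAt ℝ (fun y => fderiv ℝ f y e) x :=
  ((hf.fderiv_right (m := 1) (by norm_num)).differentiableAt (by norm_num)).clm_apply
    (differentiableAt_const e)

lemma secondDirDeriv_eq {f : R3 → ℝ} {x e : R3} (hf : ContDiffAt ℝ 2 f x) {g : ℝ → ℝ} {c : ℝ}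
    (hg : ∀ᶠ t in 𝓝 (0 : ℝ), HasDerivAt (fun s : ℝ => f (x + s • e)) (g t) t)
    (hc : HasDerivAt g c 0) :
    fderiv ℝ (fun y => fderiv ℝ f y e) x e = c := by
  have hcont : Tendsto (fun s : ℝ => x + s • e) (𝓝 0) (𝓝 x) := by
    simpa using (hasDerivAt_line x e 0).continuousAt.tendsto
  have hd : ∀ᶠ y in 𝓝 x, DifferentiableAt ℝ f y :=
    (hf.eventually (by simp)).mono fun y hy => hy.differentiableAt (by norm_num)
  have h1 : g =ᶠ[𝓝 0] fun t => fderiv ℝ f (x + t • e) e := by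
    filter_upwards [hg, hcont.eventually hd] with t ht hdt
    exact ht.unique (hdt.hasFDerivAt.comp_hasDerivAt t (hasDerivAt_line x e t))
  have h3 : HasDerivAt (fun t : ℝ => fderiv ℝ f (x + t • e) e)
      (fderiv ℝ (fun y => fderiv ℝ f y e) x e) 0 := by
    have h2' : HasFDerivAt (fun y => fderiv ℝ f y e) (fderiv ℝ (fun y => fderiv ℝ f y e) x)
      (x + (0 : ℝ) • e) := by simpa using (differentiableAt_fderiv_apply hf e).hasFDerivAt
    exact h2'.comp_hasDerivAt (0 : ℝ) (hasDerivAt_line x e 0)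
  exact (h3.congr_of_eventuallyEq h1).unique hc

lemma secondDirDeriv_nonneg_of_isLocalMin {f : R3 → ℝ} {x : R3} (hf : ContDiffAt ℝ 2 f x)
    (hmin : IsLocalMin f x) (e : R3) : 0 ≤ fderiv ℝ (fun y => fderiv ℝ f y e) x e := by
  by_contra! hneg
  have hcont : Tendsto (fun s : ℝ => x + s • e) (𝓝 0) (𝓝 x) := by
    simpa using (hasDerivAt_line x e 0).continuousAt.tendsto
  have hd : ∀ᶠ t in 𝓝 (0 : ℝ), HasDerivAt (fun s : ℝ => f (x + s • e))
      (fderiv ℝ f (x + t • e) e) t := by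
    filter_upwards [hcont.eventually (hf.eventually (by simp))] with t ht
    exact (ht.differentiableAt (by norm_num)).hasFDerivAt.comp_hasDerivAt t (hasDerivAt_line x e t)
  have h2 : HasDerivAt (fun t : ℝ => fderiv ℝ f (x + t • e) e)
      (fderiv ℝ (fun y => fderiv ℝ f y e) x e) 0 := by
    have h2' : HasFDerivAt (fun y => fderiv ℝ f y e) (fderiv ℝ (fun y => fderiv ℝ f y e) x)
      (x + (0 : ℝ) • e) := by simpa using (differentiableAt_fderiv_apply hf e).hasFDerivAt
    exact h2'.comp_hasDerivAt (0 : ℝ) (hasDerivAt_line x e 0)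
  set φ : ℝ → ℝ := fun s => f (x + s • e) with hφ
  have hmin' : IsLocalMin φ 0 := by
    have := hcont.eventually hmin
    simpa [IsLocalMin, IsMinFilter, hφ] using this
  have hderiv : deriv φ =ᶠ[𝓝 0] fun t => fderiv ℝ f (x + t • e) e :=
    hd.mono fun t ht => ht.deriv
  have hdd : deriv (deriv φ) 0 = fderiv ℝ (fun y => fderiv ℝ f y e) x e := by
    rw [hderiv.deriv_eq, h2.deriv]
  have hmax : IsLocalMax φ 0 := isLocalMax_of_deriv_deriv_neg (by rw [hdd]; exact hneg)
    hmin'.deriv_eq_zero hd.self_of_nhds.continuousAt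
  have hconst : φ =ᶠ[𝓝 0] fun _ => φ 0 := by
    filter_upwards [hmin', hmax] with t h1 h2
    exact le_antisymm h2 h1
  have hz : deriv (deriv φ) 0 = 0 := by
    have := hconst.deriv
    rw [this.deriv_eq]; simp
  linarith

lemma lap_nonneg_of_isLocalMin {f : R3 → ℝ} {x : R3} (hf : ContDiffAt ℝ 2 f x)
    (hmin : IsLocalMin f x) : 0 ≤ lap f x :=
  Finset.sum_nonneg fun _ _ => secondDirDeriv_nonneg_of_isLocalMin hf hmin _

lemma lap_sub {f g : R3 → ℝ} {x : R3} (hf : ContDiffAt ℝ 2 f x) (hg : ContDiffAt ℝ 2 g x) :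
    lap (fun y => f y - g y) x = lap f x - lap g x := by
  unfold lap
  rw [← Finset.sum_sub_distrib]
  refine Finset.sum_congr rfl fun i _ => ?_
  have h : (fun y => fderiv ℝ (fun y => f y - g y) y (EuclideanSpace.single i (1 : ℝ))) =ᶠ[𝓝 x]
      fun y => fderiv ℝ f y (EuclideanSpace.single i 1) -
        fderiv ℝ g y (EuclideanSpace.single i 1) := by
    filter_upwards [hf.eventually (by simp), hg.eventually (by simp)] with y h1 h2
    rw [fderiv_fun_sub (h1.differentiableAt (by norm_num)) (h2.differentiableAt (by norm_num))]
    rfl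
  rw [h.fderiv_eq, fderiv_fun_sub (differentiableAt_fderiv_apply hf _)
    (differentiableAt_fderiv_apply hg _)]
  rfl

lemma lap_const_mul {f : R3 → ℝ} {x : R3} (hf : ContDiffAt ℝ 2 f x) (c : ℝ) :
    lap (fun y => c * f y) x = c * lap f x := by
  unfold lap
  rw [Finset.mul_sum]
  refine Finset.sum_congr rfl fun i _ => ?_
  have h : (fun y => fderiv ℝ (fun y => c * f y) y (EuclideanSpace.single i (1 : ℝ))) =ᶠ[𝓝 x]
      fun y => c * fderiv ℝ f y (EuclideanSpace.single i 1) := by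
    filter_upwards [hf.eventually (by simp)] with y h1
    rw [fderiv_const_mul (h1.differentiableAt (by norm_num))]
    rfl
  rw [h.fderiv_eq, fderiv_const_mul (differentiableAt_fderiv_apply hf _)]
  rfl

lemma lap_const (c : ℝ) (x : R3) : lap (fun _ => c) x = 0 := by
  simp [lap]

lemma lap_comp_affine {f : R3 → ℝ} (x₀ x : R3) (l : ℝ) (hf : ContDiffAt ℝ 2 f (x₀ + l • x)) :
    lap (fun y => f (x₀ + l • y)) x = l ^ 2 * lap f (x₀ + l • x) := by
  have hA : ∀ y : R3, HasFDerivAt (fun y : R3 => x₀ + l • y)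
      (l • ContinuousLinearMap.id ℝ R3) y := fun y =>
    ((hasFDerivAt_id y).const_smul l).const_add x₀
  unfold lap
  rw [Finset.mul_sum]
  refine Finset.sum_congr rfl fun i _ => ?_
  have h : (fun y => fderiv ℝ (fun y => f (x₀ + l • y)) y (EuclideanSpace.single i (1 : ℝ)))
      =ᶠ[𝓝 x] fun y => l * fderiv ℝ f (x₀ + l • y) (EuclideanSpace.single i 1) := by
    filter_upwards [(hA x).continuousAt.eventually (hf.eventually (by simp))] with y hy
    have := ((hy.differentiableAt (by norm_num)).hasFDerivAt.comp y (hA y)).fderiv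
    simp only [Function.comp_def] at this
    rw [this]; simp
  have h2 := ((differentiableAt_fderiv_apply hf
    (EuclideanSpace.single i (1 : ℝ))).hasFDerivAt.comp x (hA x)).const_mul l
  simp only [Function.comp_def] at h2
  rw [h.fderiv_eq, h2.fderiv]
  simp
  ring

lemma lap_norm_sq (x : R3) : lap (fun y => ‖y‖ ^ 2) x = 6 := by
  have h : ∀ e : R3, fderiv ℝ (fun y => fderiv ℝ (fun y : R3 => ‖y‖ ^ 2) y e) x e = 2 * ‖e‖ ^ 2 := by
    intro e
    refine secondDirDeriv_eq (g := fun t => 2 * inner ℝ (x + t • e) e)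
      (contDiff_norm_sq ℝ).contDiffAt (Eventually.of_forall fun t => ?_) ?_
    · exact (hasDerivAt_line x e t).norm_sq
    · have := ((hasDerivAt_line x e 0).inner ℝ (hasDerivAt_const 0 e)).const_mul 2
      simpa using this
  simp only [lap, h]
  norm_num

/-- Inversion in the unit sphere. -/
def inv3 (y : R3) : R3 := (‖y‖ ^ 2)⁻¹ • y

/-- The Kelvin transform with respect to the unit sphere. -/
def kelvin (f : R3 → ℝ) (y : R3) : ℝ := ‖y‖⁻¹ * f (inv3 y)

lemma norm_inv3 (y : R3) : ‖inv3 y‖ = ‖y‖⁻¹ := by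
  rcases eq_or_ne y 0 with rfl | hy
  · simp [inv3]
  · have : ‖y‖ ≠ 0 := norm_ne_zero_iff.2 hy
    simp only [inv3, norm_smul, norm_inv, norm_pow, norm_norm]
    field_simp

lemma contDiffAt_inv3 {y : R3} (hy : y ≠ 0) : ContDiffAt ℝ 2 inv3 y := by
  unfold inv3
  exact ((contDiff_norm_sq ℝ).contDiffAt.inv (by simpa using hy)).smul contDiffAt_id

lemma contDiffAt_kelvin {f : R3 → ℝ} {y : R3} (hy : y ≠ 0) (hf : ContDiffAt ℝ 2 f (inv3 y)) :
    ContDiffAt ℝ 2 (kelvin f) y := by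
  unfold kelvin
  exact ((contDiffAt_norm ℝ hy).inv (by simpa using hy)).mul (hf.comp y (contDiffAt_inv3 hy))

lemma hasDerivAt_norm_line {x e : R3} {t : ℝ} (h : x + t • e ≠ 0) :
    HasDerivAt (fun s : ℝ => ‖x + s • e‖) (inner ℝ (x + t • e) e / ‖x + t • e‖) t := by
  have h0 : ‖x + t • e‖ ≠ 0 := norm_ne_zero_iff.2 h
  have h1 := ((hasDerivAt_line x e t).norm_sq).sqrt (by positivity)
  simp only [Real.sqrt_sq (norm_nonneg _)] at h1
  convert h1 using 1
  field_simp

lemma secondDirDeriv_kelvin {f : R3 → ℝ} {x e : R3} (hx : x ≠ 0)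
    (hf : ContDiffAt ℝ 2 f (inv3 x)) {r p : ℝ} (hr : r = ‖x‖) (hp : p = inner ℝ x e)
    (he : ‖e‖ = 1) :
    fderiv ℝ (fun y => fderiv ℝ (kelvin f) y e) x e =
      (3 * p ^ 2 / r ^ 5 - 1 / r ^ 3) * f (inv3 x)
      + fderiv ℝ f (inv3 x) ((12 * p ^ 2 / r ^ 7 - 2 / r ^ 5) • x - (6 * p / r ^ 5) • e)
      + r⁻¹ * fderiv ℝ (fderiv ℝ f) (inv3 x) ((-2 * p / r ^ 4) • x + (1 / r ^ 2) • e)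
        ((-2 * p / r ^ 4) • x + (1 / r ^ 2) • e) := by
  have hr0 : r ≠ 0 := by rw [hr]; exact norm_ne_zero_iff.2 hx
  have hcont : Tendsto (fun s : ℝ => x + s • e) (𝓝 0) (𝓝 x) := by
    simpa using (hasDerivAt_line x e 0).continuousAt.tendsto
  set ρ : ℝ → ℝ := fun t => ‖x + t • e‖ with hρ
  set q : ℝ → ℝ := fun t => inner ℝ (x + t • e) e with hq
  set J : ℝ → R3 := fun t => inv3 (x + t • e) with hJ
  set J' : ℝ → R3 := fun t => (-2 * q t / ρ t ^ 4) • (x + t • e) + (1 / ρ t ^ 2) • e with hJ'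
  have hq' : ∀ t, HasDerivAt q 1 t := fun t => by
    have := (hasDerivAt_line x e t).inner ℝ (hasDerivAt_const t e)
    simpa [he] using this
  have hρ' : ∀ t, x + t • e ≠ 0 → HasDerivAt ρ (q t / ρ t) t := fun t ht =>
    hasDerivAt_norm_line ht
  have hρne : ∀ t, x + t • e ≠ 0 → ρ t ≠ 0 := fun t ht => norm_ne_zero_iff.2 ht
  have hJd : ∀ t, x + t • e ≠ 0 → HasDerivAt J (J' t) t := fun t ht => by
    have h0 := hρne t ht
    have := (((hρ' t ht).pow 2).inv (pow_ne_zero 2 h0)).smul (hasDerivAt_line x e t)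
    refine this.congr_deriv ?_
    simp only [hJ', Pi.pow_apply, Pi.inv_apply]
    rw [add_comm]
    congr 2
    · field_simp
      push_cast
      ring
    · field_simp
  have hne : ∀ᶠ t in 𝓝 (0 : ℝ), x + t • e ≠ 0 := hcont.eventually (isOpen_ne.mem_nhds hx)
  have hx0 : x + (0 : ℝ) • e ≠ 0 := by simpa using hx
  have hJ0 : J 0 = inv3 x := by simp [hJ]
  have hq0 : q 0 = p := by simp [hq, hp]
  have hρ0 : ρ 0 = r := by simp [hρ, hr]
  have hJc : Tendsto J (𝓝 0) (𝓝 (inv3 x)) := by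
    rw [← hJ0]; exact (hJd 0 hx0).continuousAt.tendsto
  refine secondDirDeriv_eq (g := fun t => -(q t / ρ t ^ 3) * f (J t)
    + (ρ t)⁻¹ * fderiv ℝ f (J t) (J' t)) (contDiffAt_kelvin hx hf) ?_ ?_
  · filter_upwards [hne, hJc.eventually (hf.eventually (by simp))] with t ht hft
    have h0 := hρne t ht
    have h1 := ((hft.differentiableAt (by norm_num)).hasFDerivAt.comp_hasDerivAt t (hJd t ht))
    have h2 := ((hρ' t ht).inv h0).mul h1
    refine h2.congr_deriv ?_
    simp only [Pi.inv_apply, Function.comp_apply]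
    field_simp
  · have hJ'd : HasDerivAt J' ((8 * p ^ 2 / r ^ 6 - 2 / r ^ 4) • x - (4 * p / r ^ 4) • e) 0 := by
      have h0 := hρne 0 hx0
      have h1 := ((((hq' 0).const_mul (-2)).div ((hρ' 0 hx0).pow 4) (pow_ne_zero 4 h0)).smul
        (hasDerivAt_line x e 0)).add
        (((hasDerivAt_const (0:ℝ) (1:ℝ)).div ((hρ' 0 hx0).pow 2) (pow_ne_zero 2 h0)).smul_const e)
      refine h1.congr_deriv ?_
      simp only [Pi.pow_apply, Pi.div_apply, hρ0, hq0, zero_smul, add_zero]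
      rw [add_right_comm]
      have e1 : (8 * p ^ 2 / r ^ 6 - 2 / r ^ 4) • x - (4 * p / r ^ 4) • e
        = (-2 * p / r ^ 4) • e + (0 - 2 * p / r ^ 4) • e + (8 * p ^ 2 / r ^ 6 - 2 / r ^ 4) • x := by
        module
      rw [e1]
      congr 2
      · congr 2
        field_simp
        ring
      · field_simp
        ring
    have hff : HasFDerivAt (fderiv ℝ f) (fderiv ℝ (fderiv ℝ f) (inv3 x)) (J 0) := by
      rw [hJ0]
      exact ((hf.fderiv_right (m := 1) (by norm_num)).differentiableAt (by norm_num)).hasFDerivAt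
    have hf1 : HasFDerivAt f (fderiv ℝ f (inv3 x)) (J 0) := by
      rw [hJ0]
      exact (hf.differentiableAt (by norm_num)).hasFDerivAt
    have h0 := hρne 0 hx0
    have h1 := ((hff.comp_hasDerivAt (0:ℝ) (hJd 0 hx0)).clm_apply hJ'd)
    have h2 := ((hρ' 0 hx0).inv h0).mul h1
    have h3 := ((((hq' 0).div ((hρ' 0 hx0).pow 3) (pow_ne_zero 3 h0)).neg).mul
      (hf1.comp_hasDerivAt (0:ℝ) (hJd 0 hx0)))
    refine (h3.add h2).congr_deriv ?_
    have hJ'0 : J' 0 = (-2 * p / r ^ 4) • x + (1 / r ^ 2) • e := by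
      simp [hJ', hq0, hρ0]
    simp only [Pi.pow_apply, Pi.div_apply, Pi.inv_apply, Pi.neg_apply, Function.comp_apply, hρ0,
      hq0, hJ0, hJ'0, map_add, map_sub, map_smul, smul_eq_mul, _root_.add_apply,
      _root_.smul_apply]
    field_simp
    ring

lemma lap_kelvin {f : R3 → ℝ} {x : R3} (hx : x ≠ 0) (hf : ContDiffAt ℝ 2 f (inv3 x)) :
    lap (kelvin f) x = (‖x‖⁻¹) ^ 5 * lap f (inv3 x) := by
  set r := ‖x‖ with hr
  have hr0 : r ≠ 0 := norm_ne_zero_iff.2 hx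
  have hr2 : r ^ 2 = x 0 ^ 2 + x 1 ^ 2 + x 2 ^ 2 := by
    rw [hr, EuclideanSpace.norm_sq_eq, Fin.sum_univ_three]; simp
  have hxe : x = x 0 • EuclideanSpace.single 0 (1:ℝ) + x 1 • EuclideanSpace.single 1 (1:ℝ)
      + x 2 • EuclideanSpace.single 2 (1:ℝ) := by
    ext i; fin_cases i <;> simp
  have hp : ∀ i, x i = inner ℝ x (EuclideanSpace.single i (1:ℝ)) := fun i => by
    simp [EuclideanSpace.inner_single_right]
  have hd : ∀ e : R3, fderiv ℝ (fun y => fderiv ℝ f y e) (inv3 x) e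
      = fderiv ℝ (fderiv ℝ f) (inv3 x) e e := by
    intro e
    have h : DifferentiableAt ℝ (fderiv ℝ f) (inv3 x) :=
      (hf.fderiv_right (m := 1) (by norm_num)).differentiableAt (by norm_num)
    rw [fderiv_clm_apply h (differentiableAt_const e)]
    simp
  have hs : ∀ i, fderiv ℝ (fun y => fderiv ℝ (kelvin f) y (EuclideanSpace.single i 1)) x
      (EuclideanSpace.single i 1) = _ := fun i =>
    secondDirDeriv_kelvin (e := EuclideanSpace.single i 1) hx hf hr (hp i) (by simp)
  unfold lap
  simp only [hs, hd, Fin.sum_univ_three]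
  generalize fderiv ℝ (fderiv ℝ f) (inv3 x) = H
  generalize fderiv ℝ f (inv3 x) = L
  have hL : L x = x 0 * L (EuclideanSpace.single 0 (1:ℝ)) + x 1 * L (EuclideanSpace.single 1 (1:ℝ))
      + x 2 * L (EuclideanSpace.single 2 (1:ℝ)) := by
    conv_lhs => rw [hxe]
    simp only [map_add, map_smul, smul_eq_mul]
  have hH1 : ∀ v, H x v = x 0 * H (EuclideanSpace.single 0 (1:ℝ)) v
      + x 1 * H (EuclideanSpace.single 1 (1:ℝ)) v
      + x 2 * H (EuclideanSpace.single 2 (1:ℝ)) v := by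
    intro v
    conv_lhs => rw [hxe]
    simp only [map_add, map_smul, smul_eq_mul, _root_.add_apply,
      _root_.smul_apply]
  have hH2 : ∀ v, H v x = x 0 * H v (EuclideanSpace.single 0 (1:ℝ))
      + x 1 * H v (EuclideanSpace.single 1 (1:ℝ))
      + x 2 * H v (EuclideanSpace.single 2 (1:ℝ)) := by
    intro v
    conv_lhs => rw [hxe]
    simp only [map_add, map_smul, smul_eq_mul]
  simp only [map_add, map_sub, map_smul, smul_eq_mul, _root_.add_apply,
      _root_.smul_apply]
  linear_combination (norm := skip) (-(3 / r ^ 5) * f (inv3 x) - 12 / r ^ 7 * L x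
    - 4 / r ^ 9 * H x x) * hr2 + 6 / r ^ 5 * hL + 2 / r ^ 7 * hH1 x + 2 / r ^ 7 * hH2 x
  field_simp
  ring

lemma annulus_comparison {w : R3 → ℝ} {r₁ r₂ A B : ℝ} (hr₁ : 0 < r₁)
    (hc : ContinuousOn w {y | r₁ ≤ ‖y‖ ∧ ‖y‖ ≤ r₂})
    (hw : ∀ y, r₁ < ‖y‖ → ‖y‖ < r₂ → ContDiffAt ℝ 2 w y ∧ lap w y ≤ 0)
    (h₁ : ∀ y, ‖y‖ = r₁ → A + B * r₁⁻¹ ≤ w y) (h₂ : ∀ y, ‖y‖ = r₂ → A + B * r₂⁻¹ ≤ w y)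
    {y : R3} (hy₁ : r₁ ≤ ‖y‖) (hy₂ : ‖y‖ ≤ r₂) : A + B * ‖y‖⁻¹ ≤ w y := by
  suffices h : ∀ ε > 0, -(ε * r₂ ^ 2) ≤ w y - (A + B * ‖y‖⁻¹) by
    have h0 : Tendsto (fun ε : ℝ => -(ε * r₂ ^ 2)) (𝓝[>] 0) (𝓝 0) := by
      have : Continuous (fun ε : ℝ => -(ε * r₂ ^ 2)) := by fun_prop
      simpa using (this.tendsto 0).mono_left nhdsWithin_le_nhds
    have := le_of_tendsto h0 (eventually_mem_nhdsWithin.mono fun ε hε => h ε hε)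
    linarith
  intro ε hε
  set φ : R3 → ℝ := fun z => w z - A - kelvin (fun _ => B) z - ε * ‖z‖ ^ 2 with hφ
  have hcpt : IsCompact {y : R3 | r₁ ≤ ‖y‖ ∧ ‖y‖ ≤ r₂} := by
    refine (isCompact_closedBall (0 : R3) r₂).of_isClosed_subset ?_ fun z hz => by simpa using hz.2
    exact (isClosed_le continuous_const continuous_norm).inter
      (isClosed_le continuous_norm continuous_const)
  have hφc : ContinuousOn φ {y | r₁ ≤ ‖y‖ ∧ ‖y‖ ≤ r₂} := by
    refine ((hc.sub continuousOn_const).sub ?_).sub (by fun_prop)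
    intro z hz
    have hz0 : z ≠ 0 := norm_pos_iff.1 (hr₁.trans_le hz.1)
    exact (contDiffAt_kelvin hz0 contDiffAt_const).continuousAt.continuousWithinAt
  obtain ⟨z, hz, hzmin⟩ := hcpt.exists_isMinOn ⟨y, hy₁, hy₂⟩ hφc
  have hyz : φ z ≤ φ y := hzmin ⟨hy₁, hy₂⟩
  have hφval : ∀ y, φ y = w y - (A + B * ‖y‖⁻¹) - ε * ‖y‖ ^ 2 := fun y => by
    simp only [hφ, kelvin]; ring
  have hbd : -(ε * r₂ ^ 2) ≤ φ z := by
    have hsq : ε * ‖z‖ ^ 2 ≤ ε * r₂ ^ 2 := by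
      gcongr
      exact hz.2
    rcases hz.1.eq_or_lt with h | h
    · have := h₁ z h.symm
      rw [h] at this
      rw [hφval]
      linarith
    rcases hz.2.eq_or_lt with h' | h'
    · have := h₂ z h'
      rw [← h'] at this
      rw [hφval, ← h']
      linarith
    exfalso
    have hz0 : z ≠ 0 := norm_pos_iff.1 (hr₁.trans_le hz.1)
    obtain ⟨hw1, hw2⟩ := hw z h h'
    have hk : ContDiffAt ℝ 2 (kelvin fun _ => B) z := contDiffAt_kelvin hz0 contDiffAt_const
    have hs1 : ContDiffAt ℝ 2 (fun z => w z - A) z := hw1.sub contDiffAt_const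
    have hs2 : ContDiffAt ℝ 2 (fun z => w z - A - kelvin (fun _ => B) z) z := hs1.sub hk
    have hn : ContDiffAt ℝ 2 (fun z : R3 => ‖z‖ ^ 2) z := (contDiff_norm_sq ℝ).contDiffAt
    have hs3 : ContDiffAt ℝ 2 (fun z : R3 => ε * ‖z‖ ^ 2) z := contDiffAt_const.mul hn
    have hloc : IsLocalMin φ z := by
      refine hzmin.isLocalMin ?_
      have : {y : R3 | r₁ < ‖y‖ ∧ ‖y‖ < r₂} ∈ 𝓝 z :=
        ((isOpen_lt continuous_const continuous_norm).inter
          (isOpen_lt continuous_norm continuous_const)).mem_nhds ⟨h, h'⟩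
      filter_upwards [this] with y hy using ⟨hy.1.le, hy.2.le⟩
    have h6 := lap_nonneg_of_isLocalMin (hs2.sub hs3) hloc
    rw [lap_sub hs2 hs3, lap_sub hs1 hk, lap_sub hw1 contDiffAt_const, lap_const_mul hn,
      lap_norm_sq, lap_kelvin hz0 contDiffAt_const, lap_const, lap_const] at h6
    linarith
  have := hφval y
  have : 0 ≤ ε * ‖y‖ ^ 2 := by positivity
  linarith

lemma pos_on_ball {w : R3 → ℝ} {p : R3} {R : ℝ}
    (hw : ∀ y ∈ Metric.closedBall p R, ContDiffAt ℝ 2 w y ∧ lap w y ≤ 0)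
    (h0 : ∀ y ∈ Metric.closedBall p R, 0 ≤ w y) (hp : 0 < w p) :
    ∀ y ∈ Metric.ball p R, 0 < w y := by
  intro y hy
  have hR : 0 < R := dist_nonneg.trans_lt hy
  have hcont : ContinuousAt w p := (hw p (Metric.mem_closedBall_self hR.le)).1.continuousAt
  have hev : ∀ᶠ z in 𝓝 p, w p / 2 < w z := hcont.eventually (lt_mem_nhds (by linarith))
  obtain ⟨δ, hδ, hball⟩ := Metric.eventually_nhds_iff_ball.1 hev
  set ρ := min (δ / 2) (R / 2) with hρ
  have hρ0 : 0 < ρ := by positivity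
  have hρδ : ρ < δ := (min_le_left _ _).trans_lt (by linarith)
  have hρR : ρ < R := (min_le_right _ _).trans_lt (by linarith)
  rcases le_or_gt (dist y p) ρ with h | h
  · have := hball y (h.trans_lt hρδ)
    linarith
  have hinv : 0 < ρ⁻¹ - R⁻¹ := sub_pos.2 ((inv_lt_inv₀ hR hρ0).2 hρR)
  set B := w p / 2 / (ρ⁻¹ - R⁻¹) with hB
  have hB0 : 0 < B := by positivity
  have hmem : ∀ z : R3, ‖z‖ ≤ R → p + (1 : ℝ) • z ∈ Metric.closedBall p R := fun z hz => by
    simpa using hz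
  have hdiff : ∀ z : R3, ‖z‖ ≤ R → ContDiffAt ℝ 2 (fun z => w (p + (1 : ℝ) • z)) z := by
    intro z hz
    have h1 := (hw _ (hmem z hz)).1
    exact ContDiffAt.comp (g := w) z h1 (by fun_prop)
  have key := annulus_comparison (w := fun z => w (p + (1 : ℝ) • z)) (r₁ := ρ) (r₂ := R)
    (A := -(B * R⁻¹)) (B := B) hρ0
    (fun z hz => (hdiff z hz.2).continuousAt.continuousWithinAt)
    (fun z _ hz => ⟨hdiff z hz.le, by
      rw [lap_comp_affine _ _ _ (hw _ (hmem z hz.le)).1]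
      simpa using (hw _ (hmem z hz.le)).2⟩)
    (fun z hz => by
      have h1 := hball (p + (1 : ℝ) • z) (by simpa [hz] using hρδ)
      have h2 : B * (ρ⁻¹ - R⁻¹) = w p / 2 := div_mul_cancel₀ _ hinv.ne'
      linarith)
    (fun z hz => by
      have := h0 _ (hmem z hz.le)
      linarith)
    (y := y - p) (by rw [← dist_eq_norm]; exact h.le) (by rw [← dist_eq_norm]; exact hy.le)
  have hyn : ‖y - p‖ < R := by rw [← dist_eq_norm]; exact hy
  have hyn0 : 0 < ‖y - p‖ := by rw [← dist_eq_norm]; exact hρ0.trans h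
  have h3 : R⁻¹ < ‖y - p‖⁻¹ := (inv_lt_inv₀ hR hyn0).2 hyn
  have h4 : B * R⁻¹ < B * ‖y - p‖⁻¹ := by gcongr
  simp only [one_smul, add_sub_cancel] at key
  linarith

lemma isPreconnected_exterior : IsPreconnected {y : R3 | 1 < ‖y‖} := by
  have hs : IsPreconnected (Metric.sphere (0 : R3) 1) :=
    isPreconnected_sphere (by
      rw [← Module.finrank_eq_rank]; simp) 0 1
  have := (hs.prod (isPreconnected_Ioi (a := (1 : ℝ)))).image (fun q : R3 × ℝ => q.2 • q.1)
    (by fun_prop)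
  convert this using 1
  ext y
  simp only [mem_ofPred_eq, mem_image, mem_prod, Prod.exists, mem_sphere_zero_iff_norm, mem_Ioi]
  constructor
  · intro h
    refine ⟨‖y‖⁻¹ • y, ‖y‖, ⟨?_, h⟩, ?_⟩
    · rw [norm_smul, norm_inv, norm_norm, inv_mul_cancel₀ (by linarith)]
    · rw [smul_smul, mul_inv_cancel₀ (by linarith), one_smul]
  · rintro ⟨θ, t, ⟨h1, h2⟩, rfl⟩
    rw [norm_smul, h1, Real.norm_of_nonneg (by linarith)]
    linarith

lemma strong_minimum_principle {w : R3 → ℝ} {Ω : Set R3} (hΩ : IsOpen Ω) (hΩc : IsPreconnected Ω)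
    (hw : ∀ y ∈ Ω, ContDiffAt ℝ 2 w y ∧ lap w y ≤ 0) (h0 : ∀ y ∈ Ω, 0 ≤ w y)
    {y₀ : R3} (hy₀ : y₀ ∈ Ω) (hpos : 0 < w y₀) : ∀ y ∈ Ω, 0 < w y := by
  have hcont : ContinuousOn w Ω := fun y hy => (hw y hy).1.continuousAt.continuousWithinAt
  have hopen : IsOpen (Ω ∩ w ⁻¹' Ioi 0) := hcont.isOpen_inter_preimage hΩ isOpen_Ioi
  have : Ω ⊆ Ω ∩ w ⁻¹' Ioi 0 := by
    refine hΩc.subset_of_closure_inter_subset hopen ⟨y₀, hy₀, hy₀, hpos⟩ ?_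
    rintro y ⟨hyc, hyΩ⟩
    obtain ⟨r, hr, hball⟩ := Metric.isOpen_iff.1 hΩ y hyΩ
    obtain ⟨p, ⟨_, hwp⟩, hpy⟩ := Metric.mem_closure_iff.1 hyc (r / 2) (by linarith)
    have hsub : Metric.closedBall p (r / 2) ⊆ Ω := by
      refine Subset.trans (fun z hz => ?_) hball
      have := dist_triangle z p y
      rw [Metric.mem_closedBall] at hz
      rw [Metric.mem_ball]
      rw [dist_comm] at hpy
      linarith
    exact ⟨hyΩ, pos_on_ball (fun z hz => hw z (hsub hz)) (fun z hz => h0 z (hsub hz)) hwp y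
      (by simpa using hpy)⟩
  exact fun y hy => (this hy).2

lemma exterior_lower_bound {w : R3 → ℝ} {ρ m : ℝ} (hρ : 0 < ρ)
    (hw : ∀ y, ρ ≤ ‖y‖ → ContDiffAt ℝ 2 w y ∧ lap w y ≤ 0) (h0 : ∀ y, ρ ≤ ‖y‖ → 0 ≤ w y)
    (hm : 0 < m) (hwm : ∀ y, ‖y‖ = ρ → m ≤ w y) {y : R3} (hy : ρ ≤ ‖y‖) :
    m * ρ * ‖y‖⁻¹ ≤ w y := by
  have hlim : Tendsto (fun R : ℝ => -(m * ρ * R⁻¹) + m * ρ * ‖y‖⁻¹) atTop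
      (𝓝 (-(m * ρ * 0) + m * ρ * ‖y‖⁻¹)) :=
    ((tendsto_inv_atTop_zero.const_mul (m * ρ)).neg).add_const _
  have hle : ∀ᶠ R : ℝ in atTop, -(m * ρ * R⁻¹) + m * ρ * ‖y‖⁻¹ ≤ w y := by
    filter_upwards [eventually_ge_atTop ‖y‖] with R hR
    have hR0 : 0 < R := hρ.trans_le (hy.trans hR)
    refine annulus_comparison hρ
      (fun z hz => (hw z hz.1).1.continuousAt.continuousWithinAt) (fun z hz _ => hw z hz.le)
      (fun z hz => ?_) (fun z hz => ?_) hy hR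
    · have h1 : 0 ≤ m * ρ * R⁻¹ := by positivity
      have h2 : m * ρ * ρ⁻¹ = m := by field_simp
      linarith [hwm z hz]
    · have := h0 z (by rw [hz]; exact hy.trans hR)
      linarith
  have := le_of_tendsto hlim hle
  linarith

/-- Positive `C²` solutions of `-Δv = v⁵` on `ℝ³`. -/
structure IsSol (v : R3 → ℝ) : Prop where
  contDiff : ContDiff ℝ 2 v
  pos : ∀ x, 0 < v x
  lap_eq : ∀ x, lap v x = -(v x ^ 5)

lemma IsSol.rescale {u : R3 → ℝ} (hu : IsSol u) (x : R3) {l : ℝ} (hl : 0 < l) :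
    IsSol fun z => √l * u (x + l • z) := by
  refine ⟨contDiff_const.mul (hu.contDiff.comp (by fun_prop)), fun z => ?_, fun z => ?_⟩
  · have := hu.pos (x + l • z)
    positivity
  · rw [lap_const_mul (f := fun z => u (x + l • z))
      (hu.contDiff.comp (by fun_prop : ContDiff ℝ 2 fun z : R3 => x + l • z)).contDiffAt,
      lap_comp_affine _ _ _ hu.contDiff.contDiffAt, hu.lap_eq]
    have h : √l ^ 2 = l := Real.sq_sqrt hl.le
    have : √l ^ 5 = √l * l ^ 2 := by rw [← h]; ring_nf; rw [h]; ring_nf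
    rw [mul_pow, this]
    ring

/-- Twice `|y|^(1/2)` times the radial derivative of `|y|^(1/2) v(y)`. -/
def radialG (v : R3 → ℝ) (y : R3) : ℝ := v y + 2 * fderiv ℝ v y y

lemma IsSol.continuous_radialG {v : R3 → ℝ} (hv : IsSol v) : Continuous (radialG v) := by
  have h1 := hv.contDiff.continuous
  have h2 : Continuous (fderiv ℝ v) := hv.contDiff.continuous_fderiv (by norm_num)
  unfold radialG
  fun_prop

lemma IsSol.hasDerivAt_ray {v : R3 → ℝ} (hv : IsSol v) (θ : R3) (r : ℝ) :
    HasDerivAt (fun s : ℝ => v (s • θ)) (fderiv ℝ v (r • θ) θ) r := by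
  have h1 : HasDerivAt (fun s : ℝ => s • θ) θ r := by
    simpa using (hasDerivAt_id r).smul_const θ
  exact ((hv.contDiff.differentiable (by norm_num)) _).hasFDerivAt.comp_hasDerivAt r h1

lemma IsSol.sqrt_mul_ray_le {v : R3 → ℝ} (hv : IsSol v) {a b : ℝ} (ha : 0 < a) (hab : a ≤ b)
    {θ : R3} (hθ : ‖θ‖ = 1) (hG : ∀ y, a ≤ ‖y‖ → ‖y‖ ≤ b → 0 < radialG v y) :
    √a * v (a • θ) ≤ √b * v (b • θ) := by
  have hd : ∀ r, 0 < r → HasDerivAt (fun r : ℝ => √r * v (r • θ))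
      ((2 * √r)⁻¹ * radialG v (r • θ)) r := by
    intro r hr
    refine ((Real.hasDerivAt_sqrt hr.ne').mul (hv.hasDerivAt_ray θ r)).congr_deriv ?_
    have h0 : √r ≠ 0 := (Real.sqrt_pos.2 hr).ne'
    have h2 : √r ^ 2 = r := Real.sq_sqrt hr.le
    simp only [radialG, map_smul, smul_eq_mul]
    field_simp
    rw [h2]
    ring
  have hmono : MonotoneOn (fun r : ℝ => √r * v (r • θ)) (Icc a b) := by
    refine monotoneOn_of_deriv_nonneg (convex_Icc a b)
      (fun r hr => (hd r (ha.trans_le hr.1)).continuousAt.continuousWithinAt)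
      (fun r hr => ?_) fun r hr => ?_
    · rw [interior_Icc] at hr
      exact (hd r (ha.trans hr.1)).differentiableAt.differentiableWithinAt
    · rw [interior_Icc] at hr
      have hr0 := ha.trans hr.1
      rw [(hd r hr0).deriv]
      have hn : ‖r • θ‖ = r := by rw [norm_smul, hθ, Real.norm_of_nonneg hr0.le, mul_one]
      have := hG (r • θ) (by rw [hn]; exact hr.1.le) (by rw [hn]; exact hr.2.le)
      positivity
  exact hmono (left_mem_Icc.2 hab) (right_mem_Icc.2 hab) hab

/-- `v` dominates, outside the sphere of radius `l` about the origin, its Kelvin transform with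
respect to that sphere. -/
def SphereLE (v : R3 → ℝ) (l : ℝ) : Prop :=
  ∀ z, 1 ≤ ‖z‖ → ‖z‖⁻¹ * v (l • inv3 z) ≤ v (l • z)

lemma IsSol.kelvin_le_of_radialG_pos {v : R3 → ℝ} (hv : IsSol v) {l : ℝ} (hl : 0 < l) {z : R3}
    (hz : 1 ≤ ‖z‖) (hG : ∀ y, l * ‖z‖⁻¹ ≤ ‖y‖ → ‖y‖ ≤ l * ‖z‖ → 0 < radialG v y) :
    ‖z‖⁻¹ * v (l • inv3 z) ≤ v (l • z) := by
  have hz0 : 0 < ‖z‖ := by linarith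
  have hinv : ‖z‖⁻¹ ≤ 1 := inv_le_one_of_one_le₀ hz
  have h := hv.sqrt_mul_ray_le (a := l * ‖z‖⁻¹) (b := l * ‖z‖) (θ := ‖z‖⁻¹ • z) (by positivity)
    (by gcongr; linarith) (by rw [norm_smul, norm_inv, norm_norm, inv_mul_cancel₀ hz0.ne']) hG
  have e1 : (l * ‖z‖⁻¹) • ‖z‖⁻¹ • z = l • inv3 z := by
    rw [inv3, smul_smul, smul_smul]; congr 1; field_simp
  have e2 : (l * ‖z‖) • ‖z‖⁻¹ • z = l • z := by
    rw [smul_smul]; congr 1; field_simp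
  have e3 : √(l * ‖z‖⁻¹) = √(l * ‖z‖) * ‖z‖⁻¹ := by
    rw [show l * ‖z‖⁻¹ = l * ‖z‖ * (‖z‖⁻¹) ^ 2 by field_simp, Real.sqrt_mul (by positivity),
      Real.sqrt_sq (by positivity)]
  rw [e1, e2, e3, mul_assoc] at h
  exact le_of_mul_le_mul_left h (by positivity)

lemma IsSol.exists_sphereLE {v : R3 → ℝ} (hv : IsSol v) :
    ∃ l₀ > 0, ∀ l, 0 < l → l ≤ l₀ → SphereLE v l := by
  have hG0 : 0 < radialG v 0 := by simpa [radialG] using hv.pos 0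
  obtain ⟨δ, hδ, hball⟩ := Metric.eventually_nhds_iff_ball.1
    (hv.continuous_radialG.continuousAt.eventually (lt_mem_nhds hG0))
  set ρ := δ / 2 with hρ
  have hρ0 : 0 < ρ := by positivity
  have hG : ∀ y : R3, ‖y‖ ≤ ρ → 0 < radialG v y := fun y hy => hball y (by
    rw [mem_ball_zero_iff]; linarith)
  have hvc := hv.contDiff.continuous
  have hne : (Metric.closedBall (0 : R3) ρ).Nonempty := ⟨0, Metric.mem_closedBall_self hρ0.le⟩
  obtain ⟨p, -, hp⟩ := (isCompact_closedBall (0 : R3) ρ).exists_isMinOn hne hvc.continuousOn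
  obtain ⟨q, -, hq⟩ := (isCompact_closedBall (0 : R3) ρ).exists_isMaxOn hne hvc.continuousOn
  have hm := hv.pos p
  have hM := hv.pos q
  refine ⟨min ρ (v p * ρ / v q), by positivity, fun l hl hl₀ z hz => ?_⟩
  have hz0 : 0 < ‖z‖ := by linarith
  have hlρ : l ≤ ρ := hl₀.trans (min_le_left _ _)
  rcases le_or_gt (l * ‖z‖) ρ with h | h
  · exact hv.kelvin_le_of_radialG_pos hl hz fun y _ hy => hG y (hy.trans h)
  have hn : ‖l • z‖ = l * ‖z‖ := by rw [norm_smul, Real.norm_of_nonneg hl.le]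
  have h1 := exterior_lower_bound (w := v) hρ0
    (fun y _ => ⟨hv.contDiff.contDiffAt, by
      rw [hv.lap_eq]; have := hv.pos y; exact neg_nonpos.2 (by positivity)⟩)
    (fun y _ => (hv.pos y).le) hm
    (fun y hy => hp (by rw [mem_closedBall_zero_iff]; exact hy.le)) (y := l • z)
    (by rw [hn]; exact h.le)
  have hmem : l • inv3 z ∈ Metric.closedBall (0 : R3) ρ := by
    rw [mem_closedBall_zero_iff, norm_smul, norm_inv3, Real.norm_of_nonneg hl.le]
    have : ‖z‖⁻¹ ≤ 1 := inv_le_one_of_one_le₀ hz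
    nlinarith
  have h2 : v (l • inv3 z) ≤ v q := hq hmem
  have h3 : l * v q ≤ v p * ρ := (le_div_iff₀ hM).1 (hl₀.trans (min_le_right _ _))
  calc ‖z‖⁻¹ * v (l • inv3 z) ≤ ‖z‖⁻¹ * v q := by gcongr
    _ = l * v q * (l * ‖z‖)⁻¹ := by field_simp
    _ ≤ v p * ρ * (l * ‖z‖)⁻¹ := by gcongr
    _ ≤ v (l • z) := by rw [← hn]; exact h1

lemma IsSol.sub_kelvin_superharmonic {v : R3 → ℝ} (hv : IsSol v) (hle : SphereLE v 1) {y : R3}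
    (hy : 1 ≤ ‖y‖) : ContDiffAt ℝ 2 (fun y => v y - kelvin v y) y ∧
      lap (fun y => v y - kelvin v y) y ≤ 0 ∧ 0 ≤ v y - kelvin v y := by
  have hy0 : y ≠ 0 := norm_pos_iff.1 (by linarith)
  have hk := contDiffAt_kelvin hy0 (hv.contDiff.contDiffAt (x := inv3 y))
  have hvy : ContDiffAt ℝ 2 v y := hv.contDiff.contDiffAt
  have h0 : 0 ≤ v y - kelvin v y := by
    have := hle y hy
    simp only [one_smul] at this
    exact sub_nonneg.2 this
  refine ⟨hvy.sub hk, ?_, h0⟩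
  rw [lap_sub hvy hk, lap_kelvin hy0 hv.contDiff.contDiffAt, hv.lap_eq, hv.lap_eq]
  have hkp : 0 ≤ kelvin v y := mul_nonneg (by positivity) (hv.pos _).le
  have : kelvin v y ^ 5 ≤ v y ^ 5 := pow_le_pow_left₀ hkp (by linarith) 5
  have e : kelvin v y ^ 5 = ‖y‖⁻¹ ^ 5 * v (inv3 y) ^ 5 := by rw [kelvin, mul_pow]
  linarith

lemma IsSol.exists_gap {v : R3 → ℝ} (hv : IsSol v) (hle : SphereLE v 1)
    (hne : ∃ y, 1 ≤ ‖y‖ ∧ kelvin v y ≠ v y) :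
    ∃ m > 0, (∀ y, 2 ≤ ‖y‖ → m * ‖y‖⁻¹ ≤ v y - kelvin v y) ∧
      ∀ y, 1 ≤ ‖y‖ → ‖y‖ ≤ 2 → m * (1 - ‖y‖⁻¹) ≤ v y - kelvin v y := by
  have hw := fun y hy => hv.sub_kelvin_superharmonic hle (y := y) hy
  obtain ⟨y₀, hy₀, hne⟩ := hne
  have hy₀' : 1 < ‖y₀‖ := by
    refine lt_of_le_of_ne hy₀ fun h => hne ?_
    simp [kelvin, inv3, ← h]
  have hpos := strong_minimum_principle (w := fun y => v y - kelvin v y)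
    (isOpen_lt continuous_const continuous_norm) isPreconnected_exterior
    (fun y hy => ⟨(hw y (le_of_lt hy)).1, (hw y (le_of_lt hy)).2.1⟩)
    (fun y hy => (hw y (le_of_lt hy)).2.2) hy₀'
    (lt_of_le_of_ne (hw y₀ hy₀).2.2 fun h => hne (by linarith))
  have hsne : (Metric.sphere (0 : R3) 2).Nonempty := (NormedSpace.sphere_nonempty).2 (by norm_num)
  obtain ⟨p, hp, hpmin⟩ := (isCompact_sphere (0 : R3) 2).exists_isMinOn hsne
    (f := fun y => v y - kelvin v y) fun y hy => by
      rw [mem_sphere_zero_iff_norm] at hy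
      exact (hw y (by linarith)).1.continuousAt.continuousWithinAt
  rw [mem_sphere_zero_iff_norm] at hp
  have hm : 0 < v p - kelvin v p := hpos p (by simp only [mem_ofPred_eq]; linarith)
  have hmin : ∀ y, ‖y‖ = 2 → v p - kelvin v p ≤ v y - kelvin v y := fun y hy =>
    hpmin (mem_sphere_zero_iff_norm.2 hy)
  refine ⟨(v p - kelvin v p) * 2, by positivity, fun y hy => ?_, fun y h1 h2 => ?_⟩
  · exact exterior_lower_bound (w := fun y => v y - kelvin v y) (by norm_num)
      (fun y hy => ⟨(hw y (by linarith)).1, (hw y (by linarith)).2.1⟩)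
      (fun y hy => (hw y (by linarith)).2.2) hm hmin hy
  · have := annulus_comparison (w := fun y => v y - kelvin v y) (r₁ := 1) (r₂ := 2)
      (A := (v p - kelvin v p) * 2) (B := -((v p - kelvin v p) * 2)) one_pos
      (fun y hy => (hw y hy.1).1.continuousAt.continuousWithinAt)
      (fun y hy _ => ⟨(hw y hy.le).1, (hw y hy.le).2.1⟩)
      (fun y hy => by
        have := (hw y hy.ge).2.2
        norm_num
        linarith)
      (fun y hy => by
        have := hmin y hy
        norm_num
        linarith) h1 h2
    linarith

lemma IsSol.radialG_pos_of_gap {v : R3 → ℝ} (hv : IsSol v) {m : ℝ} (hm : 0 < m)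
    (hgap : ∀ y, 1 ≤ ‖y‖ → ‖y‖ ≤ 2 → m * (1 - ‖y‖⁻¹) ≤ v y - kelvin v y) {θ : R3}
    (hθ : ‖θ‖ = 1) : 0 < radialG v θ := by
  have hinv : HasDerivAt (fun r : ℝ => r⁻¹) (-1) 1 := by simpa using hasDerivAt_inv (one_ne_zero (α := ℝ))
  have h1 : HasDerivAt (fun r : ℝ => v (r • θ)) (fderiv ℝ v θ θ) 1 := by
    simpa using hv.hasDerivAt_ray θ 1
  have h2 : HasDerivAt (fun r : ℝ => v (r⁻¹ • θ)) (-fderiv ℝ v θ θ) 1 := by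
    have h3 : HasDerivAt (fun r : ℝ => v (r • θ)) (fderiv ℝ v θ θ) (1⁻¹ : ℝ) := by simpa using h1
    exact (h3.comp (1 : ℝ) hinv).congr_deriv (by ring)
  have h := (h1.sub (hinv.mul h2)).sub ((hinv.const_sub 1).const_mul m)
  set ψ : ℝ → ℝ := fun r => v (r • θ) - r⁻¹ * v (r⁻¹ • θ) - m * (1 - r⁻¹) with hψ
  have hd : HasDerivAt ψ (radialG v θ - m) 1 := by
    refine h.congr_deriv ?_
    simp [radialG]
    ring
  have hψ1 : ψ 1 = 0 := by simp [hψ]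
  have hψ0 : ∀ r, 1 < r → r < 2 → 0 ≤ ψ r := by
    intro r hr1 hr2
    have hr0 : 0 < r := by linarith
    have hn : ‖r • θ‖ = r := by rw [norm_smul, hθ, Real.norm_of_nonneg hr0.le, mul_one]
    have := hgap (r • θ) (by rw [hn]; exact hr1.le) (by rw [hn]; exact hr2.le)
    rw [kelvin, inv3, hn, smul_smul, show (r ^ 2)⁻¹ * r = r⁻¹ by field_simp] at this
    simp only [hψ]
    linarith
  have hs : Tendsto (slope ψ 1) (𝓝[>] 1) (𝓝 (radialG v θ - m)) :=
    (hasDerivAt_iff_tendsto_slope.1 hd).mono_left (nhdsWithin_mono _ fun r hr => ne_of_gt hr)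
  have : 0 ≤ radialG v θ - m := by
    refine ge_of_tendsto hs ?_
    filter_upwards [Ioo_mem_nhdsGT (show (1 : ℝ) < 2 by norm_num)] with r hr
    rw [slope_def_field, hψ1, sub_zero]
    exact div_nonneg (hψ0 r hr.1 hr.2) (by linarith [hr.1])
  linarith

lemma IsSol.eventually_sphereLE {v : R3 → ℝ} (hv : IsSol v) (hle : SphereLE v 1)
    (hne : ∃ y, 1 ≤ ‖y‖ ∧ kelvin v y ≠ v y) : ∀ᶠ l in 𝓝[>] (1 : ℝ), SphereLE v l := by
  obtain ⟨m, hm, hfar, hnear⟩ := hv.exists_gap hle hne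
  obtain ⟨δ₀, hδ₀, hsub⟩ := (isCompact_sphere (0 : R3) 1).exists_cthickening_subset_open
    (isOpen_lt continuous_const hv.continuous_radialG) (t := {y | 0 < radialG v y}) fun θ hθ =>
      hv.radialG_pos_of_gap hm hnear (mem_sphere_zero_iff_norm.1 hθ)
  set δ := min δ₀ (1 / 2) with hδdef
  have hδ : 0 < δ := by positivity
  have hδ1 : δ ≤ 1 / 2 := min_le_right _ _
  have hG : ∀ y : R3, 1 - δ ≤ ‖y‖ → ‖y‖ ≤ 1 + δ → 0 < radialG v y := by
    intro y h1 h2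
    have hy0 : 0 < ‖y‖ := by linarith
    refine hsub (Metric.mem_cthickening_of_dist_le y (‖y‖⁻¹ • y) δ₀ _ ?_ ?_)
    · rw [mem_sphere_zero_iff_norm, norm_smul, norm_inv, norm_norm, inv_mul_cancel₀ hy0.ne']
    · have : y - ‖y‖⁻¹ • y = ((‖y‖ - 1) * ‖y‖⁻¹) • y := by
        rw [sub_mul, mul_inv_cancel₀ hy0.ne', sub_smul, one_smul, one_mul]
      rw [dist_eq_norm, this, norm_smul, norm_mul, norm_inv, norm_norm, mul_assoc,
        inv_mul_cancel₀ hy0.ne', mul_one]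
      exact (abs_le.2 ⟨by linarith, by linarith⟩ : |‖y‖ - 1| ≤ δ).trans (min_le_left _ _)
  have hgap : ∀ y, 1 + δ ≤ ‖y‖ → m * δ * ‖y‖⁻¹ ≤ v y - kelvin v y := by
    intro y hy
    have hy0 : 0 < ‖y‖ := by linarith
    rcases le_or_gt 2 ‖y‖ with h | h
    · refine le_trans ?_ (hfar y h)
      gcongr
      nlinarith
    · refine le_trans ?_ (hnear y (by linarith) h.le)
      rw [mul_assoc]
      gcongr
      have : 1 - ‖y‖⁻¹ = (‖y‖ - 1) * ‖y‖⁻¹ := by field_simp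
      rw [this]
      gcongr
      linarith
  have hvc := hv.contDiff.continuous
  have hunif : ∀ᶠ l in 𝓝 (1 : ℝ), ∀ ζ ∈ Metric.closedBall (0 : R3) 1,
      l * v (l ^ 2 • ζ) < v ζ + m * δ := by
    refine (isCompact_closedBall (0 : R3) 1).eventually_forall_of_forall_eventually fun ζ _ => ?_
    have hc : Continuous fun q : ℝ × R3 => q.1 * v (q.1 ^ 2 • q.2) := by fun_prop
    have hc' : Continuous fun q : ℝ × R3 => v q.2 + m * δ := by fun_prop
    refine (isOpen_lt hc hc').mem_nhds ?_
    have : 0 < m * δ := by positivity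
    simpa using this
  filter_upwards [nhdsWithin_le_nhds hunif, self_mem_nhdsWithin] with l hl hl1 z hz
  have hl0 : (0 : ℝ) < l := one_pos.trans hl1
  have hl1' : 1 < l := hl1
  have hz0 : 0 < ‖z‖ := by linarith
  have hn : ‖l • z‖ = l * ‖z‖ := by rw [norm_smul, Real.norm_of_nonneg hl0.le]
  rcases le_or_gt (l * ‖z‖) (1 + δ) with h | h
  · refine hv.kelvin_le_of_radialG_pos hl0 hz fun y h1 h2 => hG y (le_trans ?_ h1) (h2.trans h)
    rw [← div_eq_mul_inv, le_div_iff₀ hz0]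
    nlinarith
  · have hg := hgap (l • z) (by rw [hn]; exact h.le)
    have he : l ^ 2 • inv3 (l • z) = l • inv3 z := by
      rw [inv3, hn, inv3, smul_smul, smul_smul, smul_smul]
      congr 1
      field_simp
    have hu := hl (inv3 (l • z)) (by
      rw [mem_closedBall_zero_iff, norm_inv3, hn]
      exact inv_le_one_of_one_le₀ (by linarith))
    rw [he] at hu
    rw [kelvin, hn] at hg
    have hk : ‖z‖⁻¹ * v (l • inv3 z) = (l * ‖z‖)⁻¹ * (l * v (l • inv3 z)) := by field_simp
    have hk2 : (l * ‖z‖)⁻¹ * (l * v (l • inv3 z)) ≤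
        (l * ‖z‖)⁻¹ * (v (inv3 (l • z)) + m * δ) := by gcongr
    rw [hk]
    linarith

lemma isClosed_sphereLE {v : R3 → ℝ} (hv : Continuous v) : IsClosed {l | SphereLE v l} := by
  have : {l | SphereLE v l} = ⋂ z : R3, ⋂ _ : 1 ≤ ‖z‖,
      {l : ℝ | ‖z‖⁻¹ * v (l • inv3 z) ≤ v (l • z)} := by
    ext l; simp [SphereLE]
  rw [this]
  exact isClosed_iInter fun z => isClosed_iInter fun _ => isClosed_le (by fun_prop) (by fun_prop)

lemma IsSol.moving_spheres {v : R3 → ℝ} (hv : IsSol v) :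
    (∃ l : ℝ, 0 < l ∧ ∀ z, 1 ≤ ‖z‖ → ‖z‖⁻¹ * v (l • inv3 z) = v (l • z)) ∨
      ∀ l, 0 < l → SphereLE v l := by
  by_contra! hcon
  obtain ⟨hne, M, hM, hnot⟩ := hcon
  obtain ⟨l₀, hl₀, hsmall⟩ := hv.exists_sphereLE
  have hlM : l₀ ≤ M := by
    by_contra! h
    exact hnot (hsmall M hM h.le)
  refine hnot ?_
  refine IsClosed.Icc_subset_of_forall_mem_nhdsWithin (s := {l | SphereLE v l}) (a := l₀) (b := M)
    ((isClosed_sphereLE hv.contDiff.continuous).inter isClosed_Icc) (hsmall l₀ hl₀ le_rfl) ?_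
    (right_mem_Icc.2 hlM)
  rintro l ⟨hle, hl⟩
  have hl0 : 0 < l := hl₀.trans_le hl.1
  have hsq : 0 < √l := Real.sqrt_pos.2 hl0
  have hiff : ∀ μ, SphereLE (fun z => √l * v (0 + l • z)) μ ↔ SphereLE v (l * μ) := by
    intro μ
    simp only [SphereLE, zero_add, smul_smul]
    refine forall₂_congr fun z _ => ?_
    rw [mul_left_comm, mul_le_mul_iff_right₀ hsq]
  have hev := (hv.rescale 0 hl0).eventually_sphereLE ((hiff 1).2 (by rwa [mul_one])) (by
    obtain ⟨z, hz, h⟩ := hne l hl0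
    refine ⟨z, hz, fun h' => h ?_⟩
    simp only [kelvin, zero_add] at h'
    rw [mul_left_comm] at h'
    exact mul_left_cancel₀ hsq.ne' h')
  simp only [hiff] at hev
  have ht : Tendsto (fun x : ℝ => x / l) (𝓝[>] l) (𝓝[>] 1) := by
    refine tendsto_nhdsWithin_iff.2 ⟨?_, ?_⟩
    · have : ContinuousAt (fun x : ℝ => x / l) l := by fun_prop
      have h := this.tendsto
      rw [div_self hl0.ne'] at h
      exact h.mono_left nhdsWithin_le_nhds
    · filter_upwards [self_mem_nhdsWithin] with x hx
      exact (one_lt_div hl0).2 hx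
  filter_upwards [ht.eventually hev] with x hx
  rwa [mul_div_cancel₀ _ hl0.ne'] at hx

lemma inv3_smul (c : ℝ) (y : R3) : inv3 (c • y) = c⁻¹ • inv3 y := by
  rcases eq_or_ne c 0 with rfl | hc
  · simp [inv3]
  · simp only [inv3, norm_smul, smul_smul, mul_pow, mul_inv, Real.norm_eq_abs, sq_abs]
    congr 1
    field_simp

lemma IsSol.moving_spheres_at {u : R3 → ℝ} (hu : IsSol u) (x : R3) :
    (∃ l : ℝ, 0 < l ∧ ∀ z, 1 ≤ ‖z‖ → ‖z‖⁻¹ * u (x + l • inv3 z) = u (x + l • z)) ∨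
      ∀ l : ℝ, 0 < l → ∀ z, 1 ≤ ‖z‖ → ‖z‖⁻¹ * u (x + l • inv3 z) ≤ u (x + l • z) := by
  simpa [SphereLE] using (hu.rescale x one_pos).moving_spheres

/-- With `y = t⁻¹ • e`, this is `t⁻¹` times the Kelvin transform of `u` at `y` with respect to the
sphere of center `x` and radius `l`; the expression extends smoothly to `t = 0`, i.e. `y = ∞`. -/
def kelvinAtInfty (u : R3 → ℝ) (x : R3) (l : ℝ) (e : R3) (t : ℝ) : ℝ :=
  l * (‖e - t • x‖⁻¹ * u (x + (l ^ 2 * t) • inv3 (e - t • x)))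

lemma eventually_kelvinAtInfty (u : R3 → ℝ) (x : R3) {l : ℝ} (hl : 0 < l) {e : R3}
    (he : ‖e‖ = 1) : ∀ᶠ t in 𝓝[>] (0 : ℝ), 0 < t ∧ ∃ z : R3, 1 ≤ ‖z‖ ∧ x + l • z = t⁻¹ • e ∧
      ‖z‖⁻¹ * u (x + l • inv3 z) = t * kelvinAtInfty u x l e t := by
  have hc : Continuous fun t : ℝ => ‖e - t • x‖ - l * t := by fun_prop
  have hev : ∀ᶠ t in 𝓝 (0 : ℝ), 0 < ‖e - t • x‖ - l * t :=
    hc.continuousAt.eventually (lt_mem_nhds (by simp [he]))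
  filter_upwards [nhdsWithin_le_nhds hev, self_mem_nhdsWithin] with t ht ht0
  have ht0' : 0 < t := ht0
  have hz : l⁻¹ • (t⁻¹ • e - x) = (l * t)⁻¹ • (e - t • x) := by
    rw [smul_sub, smul_sub, smul_smul, smul_smul, mul_inv, mul_assoc, inv_mul_cancel₀ ht0'.ne',
      mul_one]
  have hn : ‖l⁻¹ • (t⁻¹ • e - x)‖ = (l * t)⁻¹ * ‖e - t • x‖ := by
    rw [hz, norm_smul, Real.norm_of_nonneg (by positivity)]
  refine ⟨ht0', l⁻¹ • (t⁻¹ • e - x), ?_, ?_, ?_⟩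
  · rw [hn, ← div_eq_inv_mul, one_le_div (by positivity)]
    linarith
  · rw [smul_inv_smul₀ hl.ne']
    abel
  · rw [hn, hz, inv3_smul, inv_inv, smul_smul, kelvinAtInfty, mul_inv, inv_inv,
      show l * (l * t) = l ^ 2 * t by ring]
    ring

lemma kelvinAtInfty_zero (u : R3 → ℝ) (x : R3) (l : ℝ) {e : R3} (he : ‖e‖ = 1) :
    kelvinAtInfty u x l e 0 = l * u x := by
  simp [kelvinAtInfty, he]

lemma IsSol.hasDerivAt_kelvinAtInfty {u : R3 → ℝ} (hu : IsSol u) (x : R3) (l : ℝ) {e : R3}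
    (he : ‖e‖ = 1) : HasDerivAt (kelvinAtInfty u x l e)
      (l * u x * inner ℝ x e + l ^ 3 * fderiv ℝ u x e) 0 := by
  have he0 : e + (0 : ℝ) • (-x) ≠ 0 := by
    rw [zero_smul, add_zero]
    exact norm_ne_zero_iff.1 (by rw [he]; norm_num)
  have h1 := (hasDerivAt_norm_line he0).inv (norm_ne_zero_iff.2 he0)
  have hI : HasDerivAt (fun t : ℝ => (l ^ 2 * t) • inv3 (e + t • (-x))) (l ^ 2 • e) 0 := by
    have hI1 : DifferentiableAt ℝ (fun t : ℝ => inv3 (e + t • (-x))) 0 :=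
      DifferentiableAt.comp (g := inv3) (f := fun t : ℝ => e + t • (-x)) (0 : ℝ)
        ((contDiffAt_inv3 he0).differentiableAt (by norm_num))
        (hasDerivAt_line e (-x) 0).differentiableAt
    have := ((hasDerivAt_id (0 : ℝ)).const_mul (l ^ 2)).smul hI1.hasDerivAt
    refine this.congr_deriv ?_
    simp [inv3, he]
  have hd : HasFDerivAt u (fderiv ℝ u x) (x + (l ^ 2 * (0 : ℝ)) • inv3 (e + (0 : ℝ) • (-x))) := by
    simpa using (hu.contDiff.differentiable (by norm_num) x).hasFDerivAt
  have h2 := hd.comp_hasDerivAt (0 : ℝ) (hI.const_add x)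
  have h3 := (h1.mul h2).const_mul l
  have heq : kelvinAtInfty u x l e = fun t => l * (‖e + t • (-x)‖⁻¹ *
      u (x + (l ^ 2 * t) • inv3 (e + t • (-x)))) := by
    funext t
    simp only [kelvinAtInfty, smul_neg, sub_eq_add_neg]
  rw [heq]
  refine h3.congr_deriv ?_
  simp [he, real_inner_comm]
  ring

lemma IsSol.exists_kelvin_eq {u : R3 → ℝ} (hu : IsSol u) (x : R3) :
    ∃ l : ℝ, 0 < l ∧ ∀ z, 1 ≤ ‖z‖ → ‖z‖⁻¹ * u (x + l • inv3 z) = u (x + l • z) := by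
  by_contra hx
  have hxA := (hu.moving_spheres_at x).resolve_left hx
  set e : R3 := EuclideanSpace.single 0 1
  have he : ‖e‖ = 1 := by simp [e]
  have hA : ∀ x', ∀ l : ℝ, 0 < l → ∀ z, 1 ≤ ‖z‖ → ‖z‖⁻¹ * u (x' + l • inv3 z) ≤ u (x' + l • z) := by
    intro x'
    refine (hu.moving_spheres_at x').resolve_left ?_
    rintro ⟨l', hl', hE⟩
    have hbound : ∀ l : ℝ, 0 < l → l * u x ≤ l' * u x' := by
      intro l hl
      have h1 := (hu.hasDerivAt_kelvinAtInfty x l he).continuousAt.tendsto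
      have h2 := (hu.hasDerivAt_kelvinAtInfty x' l' he).continuousAt.tendsto
      rw [kelvinAtInfty_zero _ _ _ he] at h1 h2
      refine le_of_tendsto_of_tendsto (h1.mono_left (nhdsWithin_le_nhds (s := Ioi 0)))
        (h2.mono_left nhdsWithin_le_nhds) ?_
      filter_upwards [eventually_kelvinAtInfty u x hl he, eventually_kelvinAtInfty u x' hl' he]
        with t ⟨ht, z, hz, hz1, hz2⟩ ⟨_, z', hz', hz1', hz2'⟩
      have h3 := hxA l hl z hz
      have h4 := hE z' hz'
      rw [hz1, hz2] at h3
      rw [hz1', hz2'] at h4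
      exact le_of_mul_le_mul_left (h3.trans h4.ge) ht
    have hux := hu.pos x
    have hux' := hu.pos x'
    have := hbound ((l' * u x' + 1) / u x) (by positivity)
    rw [div_mul_cancel₀ _ hux.ne'] at this
    linarith
  have hle : ∀ y z : R3, y ≠ z → u z ≤ u y := by
    intro y z hyz
    have hd : 0 < ‖y - z‖ := norm_pos_iff.2 (sub_ne_zero.2 hyz)
    have hev : ∀ᶠ t : ℝ in atTop, √(t / (t + 1)) * u z ≤ u y := by
      filter_upwards [eventually_gt_atTop 0] with t ht
      have hr : 0 < √(t * (t + 1)) := by positivity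
      have hsq : √(t * (t + 1)) ^ 2 = t * (t + 1) := Real.sq_sqrt (by positivity)
      have hle : t ≤ √(t * (t + 1)) := Real.le_sqrt_of_sq_le (by nlinarith)
      have hle2 : √(t * (t + 1)) ≤ t + 1 := Real.sqrt_le_iff.2 ⟨by positivity, by nlinarith⟩
      have key := hA (z - t • (y - z)) (√(t * (t + 1)) * ‖y - z‖) (by positivity)
        (((t + 1) / (√(t * (t + 1)) * ‖y - z‖)) • (y - z)) (by
          rw [norm_smul, Real.norm_of_nonneg (by positivity), div_mul_eq_mul_div,
            mul_div_mul_right _ _ hd.ne', one_le_div hr]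
          exact hle2)
      have e1 : z - t • (y - z) + (√(t * (t + 1)) * ‖y - z‖) •
          ((t + 1) / (√(t * (t + 1)) * ‖y - z‖)) • (y - z) = y := by
        rw [smul_smul, mul_div_cancel₀ _ (by positivity)]
        module
      have e2 : z - t • (y - z) + (√(t * (t + 1)) * ‖y - z‖) •
          inv3 (((t + 1) / (√(t * (t + 1)) * ‖y - z‖)) • (y - z)) = z := by
        rw [inv3_smul, inv3, smul_smul, smul_smul]
        have : √(t * (t + 1)) * ‖y - z‖ * ((t + 1) / (√(t * (t + 1)) * ‖y - z‖))⁻¹ *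
            (‖y - z‖ ^ 2)⁻¹ = t := by
          field_simp
          rw [hsq]
        rw [this]
        module
      have e3 : ‖((t + 1) / (√(t * (t + 1)) * ‖y - z‖)) • (y - z)‖⁻¹ = √(t / (t + 1)) := by
        rw [norm_smul, Real.norm_of_nonneg (by positivity), div_mul_eq_mul_div,
            mul_div_mul_right _ _ hd.ne', inv_div,
            show t / (t + 1) = t * (t + 1) / (t + 1) ^ 2 by field_simp,
            Real.sqrt_div (by positivity), Real.sqrt_sq (by positivity)]
      rwa [e1, e2, e3] at key
    have hlim : Tendsto (fun t : ℝ => √(t / (t + 1)) * u z) atTop (𝓝 (√1 * u z)) := by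
      refine Tendsto.mul_const _ ((Real.continuous_sqrt.tendsto 1).comp ?_)
      have : Tendsto (fun t : ℝ => 1 - (t + 1)⁻¹) atTop (𝓝 (1 - 0)) :=
        ((tendsto_inv_atTop_zero.comp (tendsto_atTop_add_const_right _ 1 tendsto_id))).const_sub 1
      rw [sub_zero] at this
      refine this.congr' ?_
      filter_upwards [eventually_gt_atTop 0] with t ht
      field_simp
      ring
    simpa using le_of_tendsto hlim hev
  have hconst : u = fun _ => u 0 := by
    funext y
    rcases eq_or_ne y 0 with rfl | hy
    · rfl
    · exact le_antisymm (hle 0 y hy.symm) (hle y 0 hy)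
  have h0 := hu.lap_eq 0
  have hp := hu.pos 0
  rw [hconst, lap_const] at h0
  have : 0 < u 0 ^ 5 := by positivity
  simp only at h0
  linarith

lemma IsSol.exists_fderiv_eq {u : R3 → ℝ} (hu : IsSol u) : ∃ α > 0, ∃ p : R3, ∀ x e,
    fderiv ℝ u x e = u x ^ 3 * (α ^ 2)⁻¹ * inner ℝ (p - x) e := by
  choose l hl hE using hu.exists_kelvin_eq
  have key : ∀ e : R3, ‖e‖ = 1 → ∀ x, l x * u x = l 0 * u 0 ∧
      l x * u x * inner ℝ x e + l x ^ 3 * fderiv ℝ u x e = l 0 ^ 3 * fderiv ℝ u 0 e := by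
    intro e he x
    have hx := hu.hasDerivAt_kelvinAtInfty x (l x) he
    have h0 := hu.hasDerivAt_kelvinAtInfty 0 (l 0) he
    have hev : kelvinAtInfty u x (l x) e =ᶠ[𝓝[>] 0] kelvinAtInfty u 0 (l 0) e := by
      filter_upwards [eventually_kelvinAtInfty u x (hl x) he,
        eventually_kelvinAtInfty u 0 (hl 0) he] with t ⟨ht, z, hz, hz1, hz2⟩ ⟨_, z', hz', hz1', hz2'⟩
      have h3 := hE x z hz
      have h4 := hE 0 z' hz'
      rw [hz1, hz2] at h3
      rw [hz1', hz2'] at h4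
      exact mul_left_cancel₀ ht.ne' (h3.trans h4.symm)
    have hval : l x * u x = l 0 * u 0 := by
      have h1 := hx.continuousAt.tendsto.mono_left (nhdsWithin_le_nhds (s := Ioi 0))
      have h2 := h0.continuousAt.tendsto.mono_left (nhdsWithin_le_nhds (s := Ioi 0))
      rw [kelvinAtInfty_zero _ _ _ he] at h1 h2
      exact tendsto_nhds_unique (h1.congr' hev) h2
    refine ⟨hval, ?_⟩
    have h1 := hx.hasDerivWithinAt (s := Ioi 0)
    have h2 := (h0.hasDerivWithinAt (s := Ioi 0)).congr_of_eventuallyEq hev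
      (by rw [kelvinAtInfty_zero _ _ _ he, kelvinAtInfty_zero _ _ _ he, hval])
    have := (uniqueDiffWithinAt_Ioi (0 : ℝ)).eq_deriv _ h1 h2
    simpa using this
  have hα : 0 < l 0 * u 0 := mul_pos (hl 0) (hu.pos 0)
  set α := l 0 * u 0 with hαdef
  set P : R3 := (InnerProductSpace.toDual ℝ R3).symm (fderiv ℝ u 0) with hP
  have hPe : ∀ e, inner ℝ P e = fderiv ℝ u 0 e := fun e => InnerProductSpace.toDual_symm_apply
  have hunit : ∀ x e, ‖e‖ = 1 → fderiv ℝ u x e =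
      u x ^ 3 * (α ^ 2)⁻¹ * inner ℝ ((l 0 ^ 3 / α) • P - x) e := by
    intro x e he
    obtain ⟨h1, h2⟩ := key e he x
    have hux := hu.pos x
    have hlx : l x = α / u x := by rw [eq_div_iff hux.ne', h1]
    rw [h1, hlx, ← hPe] at h2
    rw [inner_sub_left, inner_smul_left]
    simp only [conj_trivial]
    field_simp at h2 ⊢
    linarith
  refine ⟨α, hα, (l 0 ^ 3 / α) • P, fun x e => ?_⟩
  rcases eq_or_ne e 0 with rfl | he
  · simp
  have hn : ‖e‖ ≠ 0 := norm_ne_zero_iff.2 he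
  have h := hunit x (‖e‖⁻¹ • e) (by rw [norm_smul, norm_inv, norm_norm, inv_mul_cancel₀ hn])
  rw [map_smul, inner_smul_right, smul_eq_mul, mul_left_comm] at h
  exact mul_left_cancel₀ (inv_ne_zero hn) h

lemma IsSol.exists_inv_sq_eq {u : R3 → ℝ} (hu : IsSol u) : ∃ α > 0, ∃ p : R3, ∀ x,
    (u x ^ 2)⁻¹ = (α ^ 2)⁻¹ * ‖x - p‖ ^ 2 + α ^ 2 / 3 := by
  obtain ⟨α, hα, p, hfd⟩ := hu.exists_fderiv_eq
  have hd : ∀ x, HasFDerivAt u (fderiv ℝ u x) x := fun x =>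
    (hu.contDiff.differentiable (by norm_num) x).hasFDerivAt
  have hline : ∀ x e, HasDerivAt (fun t : ℝ => u (x + t • e)) (fderiv ℝ u x e) 0 := fun x e => by
    have : HasFDerivAt u (fderiv ℝ u x) (x + (0 : ℝ) • e) := by simpa using hd x
    exact this.comp_hasDerivAt (0 : ℝ) (hasDerivAt_line x e 0)
  set ψ : R3 → ℝ := fun x => (u x ^ 2)⁻¹ - (α ^ 2)⁻¹ * ‖x - p‖ ^ 2 with hψ
  have hψd : Differentiable ℝ ψ := by
    intro x
    have h1 := ((hd x).differentiableAt.pow 2).fun_inv (pow_ne_zero 2 (hu.pos x).ne')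
    have h2 : DifferentiableAt ℝ (fun x : R3 => (α ^ 2)⁻¹ * ‖x - p‖ ^ 2) x :=
      ((differentiableAt_id.sub_const p).norm_sq ℝ).const_mul _
    exact h1.sub h2
  have hψ0 : ∀ x, fderiv ℝ ψ x = 0 := by
    intro x
    ext e
    have h1 : HasDerivAt (fun t : ℝ => ψ (x + t • e)) (fderiv ℝ ψ x e) 0 := by
      have : HasFDerivAt ψ (fderiv ℝ ψ x) (x + (0 : ℝ) • e) := by simpa using (hψd x).hasFDerivAt
      exact this.comp_hasDerivAt (0 : ℝ) (hasDerivAt_line x e 0)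
    have hux := (hu.pos x).ne'
    have h2 := (((hline x e).pow 2).inv (by simpa using hux)).sub
      ((((hasDerivAt_line x e 0).sub_const p).norm_sq).const_mul (α ^ 2)⁻¹)
    rw [h1.unique h2, hfd]
    have : inner ℝ (x - p) e = -inner ℝ (p - x) e := by rw [← inner_neg_left, neg_sub]
    simp [this]
    field_simp
    ring
  have hconst : ∀ x, ψ x = ψ p := fun x => is_const_of_fderiv_eq_zero hψd hψ0 x p
  have hlap : lap u p = -(3 * (u p ^ 3 * (α ^ 2)⁻¹)) := by
    have hs : ∀ i, fderiv ℝ (fun y => fderiv ℝ u y (EuclideanSpace.single i 1)) p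
        (EuclideanSpace.single i 1) = -(u p ^ 3 * (α ^ 2)⁻¹) := by
      intro i
      set e : R3 := EuclideanSpace.single i 1
      have he : ‖e‖ = 1 := by simp [e]
      refine secondDirDeriv_eq (g := fun t => fderiv ℝ u (p + t • e) e) hu.contDiff.contDiffAt
        (Eventually.of_forall fun t => (hd _).comp_hasDerivAt t (hasDerivAt_line p e t)) ?_
      simp only [hfd]
      have h1 := (((hline p e).pow 3).mul_const (α ^ 2)⁻¹).mul
        (((hasDerivAt_line p e 0).const_sub p).inner ℝ (hasDerivAt_const (0 : ℝ) e))
      refine h1.congr_deriv ?_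
      simp [he]
    simp only [lap, hs, Fin.sum_univ_three]
    ring
  have hup := hu.pos p
  have hp : (u p ^ 2)⁻¹ = α ^ 2 / 3 := by
    rw [hu.lap_eq] at hlap
    field_simp at hlap ⊢
    linarith
  refine ⟨α, hα, p, fun x => ?_⟩
  have := hconst x
  simp only [hψ, sub_self, norm_zero, hp] at this
  linarith

lemma Qb_pos (x : R3) : 0 < Qb x := by
  unfold Qb
  positivity

lemma Qb_sq (x : R3) : Qb x ^ 2 = √3 * (1 + ‖x‖ ^ 2)⁻¹ := by
  rw [Qb, mul_pow, ← Real.rpow_natCast, ← Real.rpow_natCast, ← Real.rpow_mul (by norm_num),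
    ← Real.rpow_mul (by positivity), Real.sqrt_eq_rpow, ← Real.rpow_neg_one (1 + ‖x‖ ^ 2)]
  norm_num

lemma rpow_neg_half_sq {l : ℝ} (hl : 0 < l) : (l ^ (-(1 : ℝ) / 2)) ^ 2 = l⁻¹ := by
  rw [← Real.rpow_natCast, ← Real.rpow_mul hl.le,
    show -(1 : ℝ) / 2 * (2 : ℕ) = -1 by norm_num, Real.rpow_neg_one]

lemma IsSol.eq_bubble {u : R3 → ℝ} (hu : IsSol u) : ∃ l : ℝ, 0 < l ∧ ∃ p : R3, ∀ x,
    u x = l ^ (-(1 : ℝ) / 2) * Qb (l⁻¹ • (x - p)) := by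
  obtain ⟨α, hα, p, h⟩ := hu.exists_inv_sq_eq
  have h3 : (0 : ℝ) < √3 := by positivity
  have h3' : √3 ^ 2 = (3 : ℝ) := Real.sq_sqrt (by norm_num)
  have hl : 0 < α ^ 2 / √3 := by positivity
  refine ⟨α ^ 2 / √3, hl, p, fun x => ?_⟩
  have hQ := Qb_pos ((α ^ 2 / √3)⁻¹ • (x - p))
  rw [← sq_eq_sq₀ (hu.pos x).le (by positivity), mul_pow, Qb_sq, ← inv_inj, h,
    rpow_neg_half_sq hl, norm_smul,
    Real.norm_of_nonneg (inv_nonneg.2 hl.le)]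
  field_simp
  rw [h3']
  ring

lemma differentiable_Qb : Differentiable ℝ Qb := by
  intro x
  refine DifferentiableAt.const_mul ?_ _
  exact (((differentiableAt_id (x := x)).norm_sq ℝ).const_add 1).rpow_const
    (Or.inl (by simp only [id]; positivity))

/-- The behaviour of the Dirichlet energy on `ℝ³` under rescaling. -/
lemma integral_norm_gradient_sq_comp_affine {f : R3 → ℝ} (hf : Differentiable ℝ f) (s : ℝ) {r : ℝ}
    (hr : 0 < r) (q : R3) :
    ∫ x : R3, ‖gradient (fun y => s * f (r • y + q)) x‖ ^ 2 =
      s ^ 2 * r⁻¹ * ∫ x : R3, ‖gradient f x‖ ^ 2 := by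
  have hg : ∀ x, ‖gradient (fun y => s * f (r • y + q)) x‖ ^ 2 =
      s ^ 2 * r ^ 2 * ‖gradient f (r • x + q)‖ ^ 2 := by
    intro x
    have h1 : HasFDerivAt (fun y : R3 => r • y + q) (r • ContinuousLinearMap.id ℝ R3) x :=
      ((hasFDerivAt_id x).const_smul r).add_const q
    have h2 := (((hf (r • x + q)).hasFDerivAt).comp x h1).const_mul s
    have h3 : fderiv ℝ (fun y => s * f (r • y + q)) x = (s * r) • fderiv ℝ f (r • x + q) := by
      refine h2.fderiv.trans ?_
      ext e
      simp [mul_assoc]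
    simp only [gradient, LinearIsometryEquiv.norm_map, h3, norm_smul, mul_pow, Real.norm_eq_abs,
      sq_abs]
  simp only [hg]
  rw [integral_const_mul,
    Measure.integral_comp_smul volume (fun x : R3 => ‖gradient f (x + q)‖ ^ 2) r,
    integral_add_right_eq_self (fun x : R3 => ‖gradient f x‖ ^ 2) q, finrank_euclideanSpace_fin,
    abs_of_nonneg (by positivity), smul_eq_mul]
  field_simp

/-- every positive finite-energy `C²` solution of the Kirchhoff equation
`-(a + b∫|∇u|²)Δu = u⁵` on `ℝ³` is of the form `u(x) = λ^(-1/2) Q((x/√c - x₀)/λ)` for some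
`λ > 0` and `x₀ ∈ ℝ³`, where `√c = (bk + √(b²k² + 4a))/2` and `k = ∫|∇Q|²`; i.e. the positive
solution is unique up to translations and scalings. -/
theorem kirchhoff_uniqueness (a b : ℝ) (ha : 0 < a) (hb : 0 < b)
    (u : R3 → ℝ) (hpos : ∀ x, 0 < u x) (hreg : ContDiff ℝ 2 u)
    (hfin : Integrable (fun x : R3 => ‖gradient u x‖ ^ 2))
    (heq : ∀ x, -((a + b * ∫ y : R3, ‖gradient u y‖ ^ 2) * lap u x) = u x ^ 5)
    (k : ℝ) (hk : k = ∫ x : R3, ‖gradient Qb x‖ ^ 2)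
    (sc : ℝ) (hsc : sc = (b * k + Real.sqrt (b ^ 2 * k ^ 2 + 4 * a)) / 2) :
    ∃ l : ℝ, 0 < l ∧ ∃ x₀ : R3,
      ∀ x, u x = l ^ (-(1 : ℝ) / 2) * Qb (l⁻¹ • (sc⁻¹ • x - x₀)) := by
  set c := a + b * ∫ y : R3, ‖gradient u y‖ ^ 2 with hcdef
  have hI : 0 ≤ ∫ y : R3, ‖gradient u y‖ ^ 2 := integral_nonneg fun _ => by positivity
  have hc : 0 < c := by positivity
  have ht : 0 < √c := Real.sqrt_pos.2 hc
  have htc : √c ^ 2 = c := Real.sq_sqrt hc.le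
  have hw : IsSol fun y => u (√c • y) := by
    refine ⟨by fun_prop, fun x => hpos _, fun x => ?_⟩
    have h := lap_comp_affine 0 x √c (f := u) hreg.contDiffAt
    simp only [zero_add] at h
    rw [h, htc, ← heq, neg_neg]
  obtain ⟨l, hl, p, hu⟩ := hw.eq_bubble
  have hux : ∀ x, u x = l ^ (-(1 : ℝ) / 2) * Qb (l⁻¹ • ((√c)⁻¹ • x - p)) := fun x => by
    simpa [smul_inv_smul₀ ht.ne'] using hu ((√c)⁻¹ • x)
  have hE : ∫ y : R3, ‖gradient u y‖ ^ 2 = √c * k := by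
    have hu' : u = fun x => l ^ (-(1 : ℝ) / 2) * Qb ((l * √c)⁻¹ • x + -(l⁻¹ • p)) := by
      funext x
      rw [hux, smul_sub, smul_smul, mul_inv, sub_eq_add_neg]
    rw [hk]
    conv_lhs => rw [hu']
    rw [integral_norm_gradient_sq_comp_affine differentiable_Qb _ (by positivity), rpow_neg_half_sq hl,
      inv_inv,
      inv_mul_cancel_left₀ hl.ne']
  have hsc' : sc = √c := by
    have h1 : √c ^ 2 = a + b * (√c * k) := by rw [htc, ← hE]
    have h2 : 0 < 2 * √c - b * k := by
      have : 0 < √c * (2 * √c - b * k) := by nlinarith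
      exact pos_of_mul_pos_right this ht.le
    have h3 : √(b ^ 2 * k ^ 2 + 4 * a) = 2 * √c - b * k := by
      rw [show b ^ 2 * k ^ 2 + 4 * a = (2 * √c - b * k) ^ 2 by linear_combination -4 * h1]
      exact Real.sqrt_sq h2.le
    rw [hsc, h3]
    ring
  exact ⟨l, hl, p, fun x => by rw [hsc', hux]⟩
end
end

section
/- Let a, b > 0 and let u : ℝ³ → ℝ be a positive C² function with ∫_{ℝ³}|∇u|² dx < ∞ satisfying the Kirchhoff equation -(a + b∫_{ℝ³}|∇u|² dx) Δu = u⁵ in ℝ³. Then the constant c = a + b∫_{ℝ³}|∇u|² dx depends only on a and b and not on the particular positive solution u: namely √c = (1/2)(b·k + √(b²k² + 4a)), where k = ∫_{ℝ³}|∇Q|² dx and Q(x) = 3^{1/4}(1+|x|^2)^{-1/2}. -/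
open MeasureTheory
open scoped RealInnerProductSpace

noncomputable section

/-- The `i`-th partial derivative of a function on `ℝ³`. -/
def pd (i : Fin 3) (f : R3 → ℝ) (x : R3) : ℝ := fderiv ℝ f x (EuclideanSpace.single i 1)

lemma norm_gradient_sq (f : R3 → ℝ) (x : R3) :
    ‖gradient f x‖ ^ 2 = ∑ i, pd i f x ^ 2 := by
  rw [EuclideanSpace.real_norm_sq_eq]
  refine Finset.sum_congr rfl fun i _ => ?_
  have h : inner ℝ (gradient f x) (EuclideanSpace.single i (1 : ℝ)) = pd i f x := by
    rw [gradient, InnerProductSpace.toDual_symm_apply]; rfl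
  rw [← h, EuclideanSpace.inner_single_right]
  simp

section Calculus

variable {f g : R3 → ℝ} {x : R3} (i : Fin 3)

lemma contDiff_pd {m n : WithTop ℕ∞} (hf : ContDiff ℝ n f) (h : m + 1 ≤ n) :
    ContDiff ℝ m (pd i f) :=
  (hf.fderiv_right h).clm_apply contDiff_const

lemma continuous_pd (hf : ContDiff ℝ 1 f) : Continuous (pd i f) :=
  (contDiff_pd (m := 0) i hf (by norm_num)).continuous

lemma pd_mul (hf : DifferentiableAt ℝ f x) (hg : DifferentiableAt ℝ g x) :
    pd i (fun y => f y * g y) x = f x * pd i g x + g x * pd i f x := by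
  simp [pd, fderiv_fun_mul hf hg]

lemma pd_sub (hf : DifferentiableAt ℝ f x) (hg : DifferentiableAt ℝ g x) :
    pd i (fun y => f y - g y) x = pd i f x - pd i g x := by
  simp [pd, fderiv_fun_sub hf hg]

lemma pd_const_mul (c : ℝ) (hf : DifferentiableAt ℝ f x) :
    pd i (fun y => c * f y) x = c * pd i f x := by
  simp [pd, fderiv_const_mul hf]

lemma pd_sum {F : Fin 3 → R3 → ℝ} (hF : ∀ j, DifferentiableAt ℝ (F j) x) :
    pd i (fun y => ∑ j, F j y) x = ∑ j, pd i (F j) x := by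
  simp [pd, fderiv_fun_sum fun j _ => hF j]

lemma pd_comp {φ : ℝ → ℝ} {φ' : ℝ} (hφ : HasDerivAt φ φ' (f x)) (hf : DifferentiableAt ℝ f x) :
    pd i (fun y => φ (f y)) x = φ' * pd i f x := by
  have h := (hφ.comp_hasFDerivAt x hf.hasFDerivAt).fderiv
  simp only [pd]
  rw [show (fun y => φ (f y)) = φ ∘ f from rfl, h]
  simp

lemma pd_coord (j : Fin 3) : pd i (fun y : R3 => y j) x = if i = j then 1 else 0 := by
  have h : HasFDerivAt (fun y : R3 => y j) (EuclideanSpace.proj (𝕜 := ℝ) j : R3 →L[ℝ] ℝ) x :=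
    (EuclideanSpace.proj (𝕜 := ℝ) j : R3 →L[ℝ] ℝ).hasFDerivAt
  rw [pd, h.fderiv]
  simp [PiLp.single_apply, eq_comm]

lemma eq_const_of_pd_eq_zero (hf : Differentiable ℝ f) (h : ∀ i x, pd i f x = 0) (x y : R3) :
    f x = f y := by
  refine is_const_of_fderiv_eq_zero hf (fun z => ?_) x y
  ext w
  have hw : w = ∑ i, w i • EuclideanSpace.single i (1 : ℝ) := by
    simpa using ((EuclideanSpace.basisFun (Fin 3) ℝ).sum_repr w).symm
  rw [hw, map_sum]
  simp only [map_smul]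
  refine Finset.sum_eq_zero fun i _ => ?_
  have := h i z
  simp only [pd] at this
  simp [this]

lemma pd_eq_zero_of_notMem_tsupport (h : x ∉ tsupport f) : pd i f x = 0 := by
  have : fderiv ℝ f x = 0 := by
    by_contra hne
    exact h (support_fderiv_subset ℝ hne)
  simp [pd, this]

lemma hasCompactSupport_pd (hf : HasCompactSupport f) : HasCompactSupport (pd i f) :=
  hf.fderiv_apply ℝ _

lemma pd_comm (hf : ContDiff ℝ 2 f) (i j : Fin 3) (x : R3) :
    pd i (pd j f) x = pd j (pd i f) x := by
  have hs : IsSymmSndFDerivAt ℝ f x := hf.contDiffAt.isSymmSndFDerivAt (by simp)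
  have hd : DifferentiableAt ℝ (fderiv ℝ f) x :=
    ((hf.fderiv_right (m := 1) (by norm_num)).differentiable (by norm_num)) x
  have key : ∀ a b : Fin 3, pd a (pd b f) x =
      fderiv ℝ (fderiv ℝ f) x (EuclideanSpace.single a 1) (EuclideanSpace.single b 1) := by
    intro a b
    have : pd b f = fun y => fderiv ℝ f y (EuclideanSpace.single b 1) := rfl
    rw [this, pd, fderiv_clm_apply hd (differentiableAt_const _)]
    simp
  rw [key, key, hs.eq]

end Calculus

section Integration

variable {f g : R3 → ℝ}

lemma integral_mul_pd (i : Fin 3) (hf : ContDiff ℝ 1 f) (hg : ContDiff ℝ 1 g)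
    (hc : HasCompactSupport g) : ∫ x, f x * pd i g x = -∫ x, pd i f x * g x := by
  refine integral_mul_fderiv_eq_neg_fderiv_mul_of_integrable ?_ ?_ ?_ ?_ ?_
  · exact ((continuous_pd i hf).mul hg.continuous).integrable_of_hasCompactSupport hc.mul_left
  · exact (hf.continuous.mul (continuous_pd i hg)).integrable_of_hasCompactSupport
      (hasCompactSupport_pd i hc).mul_left
  · exact (hf.continuous.mul hg.continuous).integrable_of_hasCompactSupport hc.mul_left
  · exact fun x _ => hf.differentiable (by norm_num) x
  · exact fun x _ => hg.differentiable (by norm_num) x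

lemma integral_pd_eq_zero (i : Fin 3) (hg : ContDiff ℝ 1 g) (hc : HasCompactSupport g) :
    ∫ x, pd i g x = 0 := by
  have h := integral_mul_pd i (f := fun _ => (1 : ℝ)) contDiff_const hg hc
  have h0 : ∀ x, pd i (fun _ : R3 => (1 : ℝ)) x = 0 := fun x => by simp [pd]
  simpa [h0] using h

lemma integrable_of_continuous_compact (hf : Continuous f) (hc : HasCompactSupport f) :
    Integrable f :=
  hf.integrable_of_hasCompactSupport hc

lemma hasDerivAt_integral_translate (e : R3) (hf : ContDiff ℝ 1 f) (hcf : HasCompactSupport f)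
    (hg : Continuous g) (hcg : HasCompactSupport g) :
    HasDerivAt (fun t : ℝ => ∫ x, f (x + t • e) * g x) (∫ x, fderiv ℝ f x e * g x) 0 := by
  have hcont : Continuous fun x => fderiv ℝ f x e :=
    (hf.continuous_fderiv (by norm_num)).clm_apply continuous_const
  obtain ⟨M, hM⟩ := hcont.bounded_above_of_compact_support (hcf.fderiv_apply ℝ e)
  have h := (hasDerivAt_integral_of_dominated_loc_of_deriv_le (μ := (volume : Measure R3))
    (F := fun (t : ℝ) x => f (x + t • e) * g x)
    (F' := fun (t : ℝ) x => fderiv ℝ f (x + t • e) e * g x)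
    (bound := fun x => M * ‖g x‖) (x₀ := 0) Filter.univ_mem ?_ ?_ ?_ ?_ ?_ ?_).2
  · simpa using h
  · refine .of_forall fun t => Continuous.aestronglyMeasurable ?_
    exact (hf.continuous.comp (by fun_prop)).mul hg
  · refine integrable_of_continuous_compact ?_ hcg.mul_left
    exact (hf.continuous.comp (by fun_prop)).mul hg
  · exact ((hcont.comp (by fun_prop : Continuous fun x : R3 => x + (0 : ℝ) • e)).mul
      hg).aestronglyMeasurable
  · refine .of_forall fun x t _ => ?_
    rw [norm_mul]
    exact mul_le_mul_of_nonneg_right (hM _) (norm_nonneg _)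
  · exact (integrable_of_continuous_compact hg hcg).norm.const_mul M
  · refine .of_forall fun x t _ => HasDerivAt.mul_const ?_ _
    have h1 : HasDerivAt (fun s : ℝ => x + s • e) e t := by
      simpa using ((hasDerivAt_id t).smul_const e).const_add x
    exact ((hf.differentiable (by norm_num) _).hasFDerivAt).comp_hasDerivAt t h1

lemma integral_pd_mul_pd_comm_of_hasCompactSupport (i j : Fin 3) (hf : ContDiff ℝ 1 f)
    (hcf : HasCompactSupport f) (hg : ContDiff ℝ 1 g) (hcg : HasCompactSupport g) :
    ∫ x, pd i f x * pd j g x = ∫ x, pd j f x * pd i g x := by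
  set e : R3 := EuclideanSpace.single i 1 with he
  have h1 := hasDerivAt_integral_translate e hf hcf (continuous_pd j hg)
    (hasCompactSupport_pd j hcg)
  have h2 := hasDerivAt_integral_translate e hg hcg (continuous_pd j hf)
    (hasCompactSupport_pd j hcf)
  have h2' : HasDerivAt (fun t : ℝ => -∫ x, g (x + (-t) • e) * pd j f x)
      (∫ x, fderiv ℝ g x e * pd j f x) 0 := by
    have h0 : HasDerivAt (fun t : ℝ => ∫ x, g (x + t • e) * pd j f x)
      (∫ x, fderiv ℝ g x e * pd j f x) (-0) := by simpa using h2
    exact (h0.comp (0 : ℝ) (hasDerivAt_neg 0)).fun_neg.congr_deriv (by simp)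
  have hEq : (fun t : ℝ => ∫ x, f (x + t • e) * pd j g x) =
      fun t : ℝ => -∫ x, g (x + (-t) • e) * pd j f x := by
    ext t
    have hft : ContDiff ℝ 1 fun x => f (x + t • e) := hf.comp (by fun_prop)
    rw [integral_mul_pd j hft hg hcg]
    congr 1
    rw [← integral_add_right_eq_self (fun x => g (x + (-t) • e) * pd j f x) (t • e)]
    refine integral_congr_ae (.of_forall fun x => ?_)
    have : pd j (fun x => f (x + t • e)) x = pd j f (x + t • e) := by
      simp [pd, fderiv_comp_add_right]
    simp [this, mul_comm, add_assoc]
  rw [hEq] at h1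
  have := h1.unique h2'
  exact this.trans (integral_congr_ae (.of_forall fun x => mul_comm _ _))

lemma integral_pd_mul_pd_comm (i j : Fin 3) (hf : ContDiff ℝ 1 f) (hg : ContDiff ℝ 1 g)
    (hcg : HasCompactSupport g) :
    ∫ x, pd i f x * pd j g x = ∫ x, pd j f x * pd i g x := by
  obtain ⟨r, hr⟩ := hcg.isCompact.isBounded.subset_ball (0 : R3)
  let χ : ContDiffBump (0 : R3) := ⟨max r 1, max r 1 + 1, by positivity, by linarith⟩
  have hχ : ContDiff ℝ 1 fun x => χ x * f x := χ.contDiff.mul hf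
  have hcχ : HasCompactSupport fun x => χ x * f x := χ.hasCompactSupport.mul_right
  have key : ∀ a b : Fin 3, ∀ x, pd a f x * pd b g x = pd a (fun x => χ x * f x) x * pd b g x := by
    intro a b x
    by_cases hx : x ∈ tsupport g
    · have hx' : x ∈ Metric.ball (0 : R3) (max r 1) :=
        Metric.ball_subset_ball (le_max_left _ _) (hr hx)
      have : (fun x => χ x * f x) =ᶠ[nhds x] f := by
        filter_upwards [Metric.isOpen_ball.mem_nhds hx'] with y hy
        rw [χ.one_of_mem_closedBall (Metric.ball_subset_closedBall hy), one_mul]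
      simp only [pd, this.fderiv_eq]
    · simp [pd_eq_zero_of_notMem_tsupport b hx]
  simp_rw [key]
  exact integral_pd_mul_pd_comm_of_hasCompactSupport i j hχ hcχ hg hcg

end Integration

section Algebra

lemma traceless_apply_sq_le (e : Fin 3 → Fin 3 → ℝ) (w : Fin 3 → ℝ)
    (hs : ∀ i j, e i j = e j i) (ht : ∑ i, e i i = 0) :
    ∑ i, (∑ j, e i j * w j) ^ 2 ≤ 3 / 4 * (∑ i, w i ^ 2) * ∑ i, ∑ j, e i j ^ 2 := by
  set p : Fin 3 → ℝ := fun i => ∑ j, e i j * w j with hp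
  set W := ∑ i, w i ^ 2 with hW
  set q := ∑ i, w i * p i with hq
  have hqW : q ^ 2 ≤ W * ∑ i, p i ^ 2 := Finset.sum_mul_sq_le_sq_mul_sq _ _ _
  have hid : ∑ i, ∑ j, (W * e i j - w i * p j - p i * w j + (if i = j then 2 / 3 * q else 0)) ^ 2
      = W ^ 2 * (∑ i, ∑ j, e i j ^ 2) - 2 * W * (∑ i, p i ^ 2) + 2 / 3 * q ^ 2 := by
    have h10 := hs 1 0
    have h20 := hs 2 0
    have h21 := hs 2 1
    have h22 : e 2 2 = -e 0 0 - e 1 1 := by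
      rw [Fin.sum_univ_three] at ht; linarith
    simp only [hq, hW, hp, Fin.sum_univ_three, h10, h20, h21, h22]
    simp
    ring
  have hnn : 0 ≤ W ^ 2 * (∑ i, ∑ j, e i j ^ 2) - 2 * W * (∑ i, p i ^ 2) + 2 / 3 * q ^ 2 := by
    rw [← hid]; positivity
  have hW0 : 0 ≤ W := by positivity
  rcases hW0.eq_or_lt with h0 | hpos
  · have hw : ∀ i, w i = 0 := fun i => by
      have := (Finset.sum_eq_zero_iff_of_nonneg (fun i _ => sq_nonneg (w i))).1 (hW ▸ h0.symm) i
        (Finset.mem_univ i)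
      exact pow_eq_zero_iff (two_ne_zero) |>.1 this
    simp [hw, ← h0]
  · refine le_of_mul_le_mul_left ?_ hpos
    nlinarith

variable (r ψ P : ℝ) (w dψ dP : Fin 3 → ℝ) (h : Fin 3 → Fin 3 → ℝ)

lemma sum_sq_traceless (hP : P = ∑ i, h i i) :
    ∑ i, ∑ j, (h i j - if i = j then P / 3 else 0) ^ 2 = (∑ i, ∑ j, h i j ^ 2) - P ^ 2 / 3 := by
  simp only [Fin.sum_univ_three] at hP ⊢
  simp [hP]
  ring

lemma divergence_identity (hs : ∀ i j, h i j = h j i) (hP : P = ∑ i, h i i)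
    (hdP : ∀ i, dP i = r * (3 * (∑ j, h i j * w j) - P * w i)) :
    r ^ 2 * ψ * ((∑ i, ∑ j, h i j ^ 2) - P ^ 2 / 3) + 1 / 3 * r * ∑ i, dP i * dψ i =
      (∑ i, ∑ j, (h i j * (r ^ 2 * w i * dψ j + ψ * (r ^ 2 * h j i - 2 * r ^ 3 * w j * w i))
        - h j j * (r ^ 2 * w i * dψ i + ψ * (r ^ 2 * h i i - 2 * r ^ 3 * w i * w i)))) +
      2 / 3 * ∑ i, (r ^ 2 * w i * (P * dψ i + ψ * dP i) +
        P * ψ * (r ^ 2 * h i i - 2 * r ^ 3 * w i * w i)) := by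
  have h10 := hs 1 0
  have h20 := hs 2 0
  have h21 := hs 2 1
  simp only [hdP, hP, Fin.sum_univ_three, h10, h20, h21]
  ring

lemma sum_gradient_sq_le (hs : ∀ i j, h i j = h j i) (hP : P = ∑ i, h i i)
    (hdP : ∀ i, dP i = r * (3 * (∑ j, h i j * w j) - P * w i)) (hr : 0 < r)
    (hw : r * ∑ i, w i ^ 2 ≤ 2 / 3 * P) :
    ∑ i, dP i ^ 2 ≤ 9 / 2 * r * P * ((∑ i, ∑ j, h i j ^ 2) - P ^ 2 / 3) := by
  have h1 := traceless_apply_sq_le (fun i j => h i j - if i = j then P / 3 else 0) w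
    (fun i j => by simp [hs i j, eq_comm]) (by
      simp only [Fin.sum_univ_three] at hP ⊢; simp [hP]; ring)
  rw [sum_sq_traceless P h hP] at h1
  have h2 : ∑ i, dP i ^ 2 =
      9 * r ^ 2 * ∑ i, (∑ j, (h i j - if i = j then P / 3 else 0) * w j) ^ 2 := by
    simp only [hdP, Fin.sum_univ_three]
    simp
    ring
  have hS : 0 ≤ (∑ i, ∑ j, h i j ^ 2) - P ^ 2 / 3 := by
    rw [← sum_sq_traceless P h hP]; positivity
  rw [h2]
  set S := (∑ i, ∑ j, h i j ^ 2) - P ^ 2 / 3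
  calc _ ≤ 9 * r ^ 2 * (3 / 4 * (∑ i, w i ^ 2) * S) := by gcongr
    _ = 27 / 4 * r * S * (r * ∑ i, w i ^ 2) := by ring
    _ ≤ 27 / 4 * r * S * (2 / 3 * P) := by gcongr
    _ = _ := by ring

lemma cutoff_lower_bound (η p S : ℝ) (dη dp : Fin 3 → ℝ) (hr : 0 < r) (hp : 0 < p)
    (hdp : ∑ i, dp i ^ 2 ≤ 9 / 8 * r * S) :
    1 / 8 * (η ^ 2 * (r ^ 2 * S / p)) - 4 * (r * p * ∑ i, dη i ^ 2) ≤
      r ^ 2 * (η ^ 2 * p⁻¹) * S + 1 / 3 * r *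
        ∑ i, (2 * p * dp i) * (η ^ 2 * (-(p ^ 2)⁻¹ * dp i) + p⁻¹ * (2 * η * dη i)) := by
  have key : (r ^ 2 * (η ^ 2 * p⁻¹) * S + 1 / 3 * r *
        ∑ i, (2 * p * dp i) * (η ^ 2 * (-(p ^ 2)⁻¹ * dp i) + p⁻¹ * (2 * η * dη i))) -
      (1 / 8 * (η ^ 2 * (r ^ 2 * S / p)) - 4 * (r * p * ∑ i, dη i ^ 2)) =
      7 / 9 * (r * p⁻¹ * η ^ 2) * (9 / 8 * r * S - ∑ i, dp i ^ 2) +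
      r * p⁻¹ * ∑ i, (1 / 3 * η * dp i + 2 * p * dη i) ^ 2 := by
    simp only [Fin.sum_univ_three]
    field_simp
    ring
  have h1 : 0 ≤ 7 / 9 * (r * p⁻¹ * η ^ 2) * (9 / 8 * r * S - ∑ i, dp i ^ 2) :=
    mul_nonneg (by positivity) (by linarith)
  have h2 : 0 ≤ r * p⁻¹ * ∑ i, (1 / 3 * η * dp i + 2 * p * dη i) ^ 2 := by positivity
  linarith

end Algebra

lemma lap_eq_sum_pd (v : R3 → ℝ) (x : R3) : lap v x = ∑ j, pd j (pd j v) x := rfl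

/-- The squared norm of the trace-free part of the Hessian. -/
def hessDefect (v : R3 → ℝ) (x : R3) : ℝ :=
  (∑ i, ∑ j, pd i (pd j v) x ^ 2) - lap v x ^ 2 / 3

section Obata

variable {v : R3 → ℝ} {m : ℝ}

lemma hessDefect_nonneg (x : R3) : 0 ≤ hessDefect v x := by
  rw [hessDefect, ← sum_sq_traceless _ _ (lap_eq_sum_pd v x)]
  positivity

lemma continuous_pd_pd (hv : ContDiff ℝ 2 v) (i j : Fin 3) : Continuous (pd i (pd j v)) :=
  continuous_pd i (contDiff_pd j hv (by norm_num))

lemma continuous_hessDefect (hv : ContDiff ℝ 2 v) : Continuous (hessDefect v) := by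
  have h := continuous_pd_pd hv
  have hl : Continuous (lap v) := by
    rw [funext (lap_eq_sum_pd v)]; fun_prop
  unfold hessDefect
  fun_prop

lemma lap_eq_div (hpos : ∀ x, 0 < v x)
    (heq : ∀ x, v x * lap v x = 3 / 2 * ∑ i, pd i v x ^ 2 + m) :
    lap v = fun x => (3 / 2 * ∑ i, pd i v x ^ 2 + m) * (v x)⁻¹ := by
  ext x
  rw [← heq x, mul_comm (v x), mul_inv_cancel_right₀ (hpos x).ne']

lemma contDiff_lap (hv : ContDiff ℝ 2 v) (hpos : ∀ x, 0 < v x)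
    (heq : ∀ x, v x * lap v x = 3 / 2 * ∑ i, pd i v x ^ 2 + m) : ContDiff ℝ 1 (lap v) := by
  rw [lap_eq_div hpos heq]
  have h1 : ∀ i, ContDiff ℝ 1 (pd i v) := fun i => contDiff_pd i hv (by norm_num)
  have h2 : ContDiff ℝ 1 fun x => (v x)⁻¹ :=
    (hv.of_le (by norm_num)).inv fun x => (hpos x).ne'
  exact (((contDiff_const).mul (ContDiff.sum fun i _ => (h1 i).pow 2)).add contDiff_const).mul h2

lemma pd_lap (hv : ContDiff ℝ 2 v) (hpos : ∀ x, 0 < v x)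
    (heq : ∀ x, v x * lap v x = 3 / 2 * ∑ i, pd i v x ^ 2 + m) (i : Fin 3) (x : R3) :
    pd i (lap v) x = (v x)⁻¹ * (3 * (∑ j, pd i (pd j v) x * pd j v x) - lap v x * pd i v x) := by
  have hl := (contDiff_lap hv hpos heq).differentiable (by norm_num) x
  have hvd := hv.differentiable (by norm_num) x
  have h1 : ∀ j, DifferentiableAt ℝ (pd j v) x :=
    fun j => (contDiff_pd (m := 1) j hv (by norm_num)).differentiable (by norm_num) x
  have e1 := pd_mul i hvd hl
  have e2 : pd i (fun y => v y * lap v y) x = ∑ j, 3 * (pd i (pd j v) x * pd j v x) := by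
    rw [funext heq]
    have : (fun y => 3 / 2 * ∑ j, pd j v y ^ 2 + m) =
        fun y => (∑ j, 3 / 2 * pd j v y ^ 2) - (-m) := by
      ext y; rw [Finset.mul_sum]; ring
    rw [this, pd_sub i (by fun_prop) (by fun_prop), pd_sum i (fun j => by fun_prop)]
    have h0 : pd i (fun _ : R3 => -m) x = 0 := by simp [pd]
    rw [h0, sub_zero]
    refine Finset.sum_congr rfl fun j _ => ?_
    have hd : HasDerivAt (fun t : ℝ => 3 / 2 * t ^ 2) (3 * pd j v x) (pd j v x) :=
      ((hasDerivAt_pow 2 (pd j v x)).const_mul (3 / 2)).congr_deriv (by norm_num; ring)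
    rw [pd_comp i hd (h1 j)]
    ring
  have hne := (hpos x).ne'
  rw [← Finset.mul_sum] at e2
  rw [eq_inv_mul_iff_mul_eq₀ hne, ← e2, e1]
  ring

lemma pd_inv (i : Fin 3) {x : R3} (hv : DifferentiableAt ℝ v x) (hne : v x ≠ 0) :
    pd i (fun y => (v y)⁻¹) x = -(v x ^ 2)⁻¹ * pd i v x :=
  pd_comp i (hasDerivAt_inv hne) hv

lemma integral_obata (hv : ContDiff ℝ 2 v) (hpos : ∀ x, 0 < v x)
    (heq : ∀ x, v x * lap v x = 3 / 2 * ∑ i, pd i v x ^ 2 + m)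
    {ψ : R3 → ℝ} (hψ : ContDiff ℝ 1 ψ) (hc : HasCompactSupport ψ) :
    ∫ x, ((v x)⁻¹ ^ 2 * ψ x * hessDefect v x +
      1 / 3 * (v x)⁻¹ * ∑ i, pd i (lap v) x * pd i ψ x) = 0 := by
  have hl := contDiff_lap hv hpos heq
  have h1 : ∀ i, ContDiff ℝ 1 (pd i v) := fun i => contDiff_pd i hv (by norm_num)
  have hr : ContDiff ℝ 1 fun x => (v x)⁻¹ :=
    (hv.of_le (by norm_num)).inv fun x => (hpos x).ne'
  have hvd := hv.differentiable (by norm_num)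
  have hF : ∀ i, ContDiff ℝ 1 fun x => (v x)⁻¹ ^ 2 * pd i v x := fun i => (hr.pow 2).mul (h1 i)
  have hdF : ∀ i j x, pd j (fun x => (v x)⁻¹ ^ 2 * pd i v x) x =
      (v x)⁻¹ ^ 2 * pd j (pd i v) x - 2 * (v x)⁻¹ ^ 3 * pd j v x * pd i v x := by
    intro i j x
    have hd : HasDerivAt (fun t : ℝ => t⁻¹ ^ 2) (-2 * (v x)⁻¹ ^ 3) (v x) :=
      ((hasDerivAt_inv (hpos x).ne').fun_pow 2).congr_deriv (by
        have := (hpos x).ne'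
        norm_num
        field_simp)
    rw [pd_mul j ((hr.pow 2).differentiable (by norm_num) x)
      ((h1 i).differentiable (by norm_num) x), pd_comp j hd (hvd x)]
    ring
  set φ : Fin 3 → R3 → ℝ := fun i x => ((v x)⁻¹ ^ 2 * pd i v x) * ψ x with hφdef
  have hφ : ∀ i, ContDiff ℝ 1 (φ i) := fun i => (hF i).mul hψ
  have hφc : ∀ i, HasCompactSupport (φ i) := fun i => hc.mul_left
  have hdφ : ∀ i j x, pd j (φ i) x = (v x)⁻¹ ^ 2 * pd i v x * pd j ψ x +
      ψ x * ((v x)⁻¹ ^ 2 * pd j (pd i v) x - 2 * (v x)⁻¹ ^ 3 * pd j v x * pd i v x) := by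
    intro i j x
    rw [hφdef, pd_mul j ((hF i).differentiable (by norm_num) x)
      (hψ.differentiable (by norm_num) x), hdF]
  set G : Fin 3 → R3 → ℝ := fun i x => ((v x)⁻¹ ^ 2 * pd i v x) * (lap v x * ψ x) with hGdef
  have hG : ∀ i, ContDiff ℝ 1 (G i) := fun i => (hF i).mul (hl.mul hψ)
  have hGc : ∀ i, HasCompactSupport (G i) := fun i => hc.mul_left.mul_left
  have hdG : ∀ i x, pd i (G i) x =
      (v x)⁻¹ ^ 2 * pd i v x * (lap v x * pd i ψ x + ψ x * pd i (lap v) x) +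
      lap v x * ψ x * ((v x)⁻¹ ^ 2 * pd i (pd i v) x -
        2 * (v x)⁻¹ ^ 3 * pd i v x * pd i v x) := by
    intro i x
    rw [hGdef, pd_mul i ((hF i).differentiable (by norm_num) x)
      ((hl.mul hψ).differentiable (by norm_num) x), hdF,
      pd_mul i (hl.differentiable (by norm_num) x) (hψ.differentiable (by norm_num) x)]
  have hpt : ∀ x, (v x)⁻¹ ^ 2 * ψ x * hessDefect v x +
      1 / 3 * (v x)⁻¹ * ∑ i, pd i (lap v) x * pd i ψ x =
      (∑ i, ∑ j, (pd i (pd j v) x * pd j (φ i) x - pd j (pd j v) x * pd i (φ i) x)) +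
      2 / 3 * ∑ i, pd i (G i) x := by
    intro x
    simp only [hdφ, hdG]
    exact divergence_identity (v x)⁻¹ (ψ x) (lap v x) (fun i => pd i v x) (fun i => pd i ψ x)
      (fun i => pd i (lap v) x) (fun i j => pd i (pd j v) x) (fun i j => pd_comm hv i j x)
      (lap_eq_sum_pd v x) (fun i => pd_lap hv hpos heq i x)
  have hint : ∀ i j k l, Integrable fun x => pd i (pd j v) x * pd k (φ l) x := fun i j k l =>
    integrable_of_continuous_compact ((continuous_pd_pd hv i j).mul (continuous_pd k (hφ l)))
      (hasCompactSupport_pd k (hφc l)).mul_left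
  have hsub : ∀ i j, Integrable fun x =>
      pd i (pd j v) x * pd j (φ i) x - pd j (pd j v) x * pd i (φ i) x := fun i j =>
    (hint _ _ _ _).sub (hint _ _ _ _)
  have hintG : ∀ i, Integrable (pd i (G i)) := fun i =>
    integrable_of_continuous_compact (continuous_pd i (hG i)) (hasCompactSupport_pd i (hGc i))
  simp_rw [hpt]
  rw [integral_add, integral_finsetSum, integral_const_mul, integral_finsetSum]
  · have e1 : ∀ i, ∫ x, pd i (G i) x = 0 := fun i => integral_pd_eq_zero i (hG i) (hGc i)
    have e2 : ∀ i, ∫ x, ∑ j, (pd i (pd j v) x * pd j (φ i) x - pd j (pd j v) x * pd i (φ i) x)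
        = 0 := by
      intro i
      rw [integral_finsetSum _ fun j _ => hsub i j]
      refine Finset.sum_eq_zero fun j _ => ?_
      rw [integral_sub (hint _ _ _ _) (hint _ _ _ _),
        integral_pd_mul_pd_comm i j (h1 j) (hφ i) (hφc i), sub_self]
    rw [Finset.sum_eq_zero fun i _ => e2 i, Finset.sum_eq_zero fun i _ => e1 i]
    simp
  · exact fun i _ => hintG i
  · exact fun i _ => integrable_finsetSum _ fun j _ => hsub i j
  · exact integrable_finsetSum _ fun i _ => integrable_finsetSum _ fun j _ =>
      hsub i j
  · exact (integrable_finsetSum _ fun i _ => hintG i).const_mul _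

lemma lap_pos (hpos : ∀ x, 0 < v x) (hm : 0 < m)
    (heq : ∀ x, v x * lap v x = 3 / 2 * ∑ i, pd i v x ^ 2 + m) (x : R3) : 0 < lap v x := by
  refine pos_of_mul_pos_right (a := v x) ?_ (hpos x).le
  rw [heq]
  positivity

lemma sum_pd_lap_sq_le (hv : ContDiff ℝ 2 v) (hpos : ∀ x, 0 < v x) (hm : 0 < m)
    (heq : ∀ x, v x * lap v x = 3 / 2 * ∑ i, pd i v x ^ 2 + m) (x : R3) :
    ∑ i, pd i (lap v) x ^ 2 ≤ 9 / 2 * (v x)⁻¹ * lap v x * hessDefect v x := by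
  refine sum_gradient_sq_le (v x)⁻¹ (lap v x) (fun i => pd i v x)
      (fun i => pd i (lap v) x) (fun i j => pd i (pd j v) x) (fun i j => pd_comm hv i j x)
      (lap_eq_sum_pd v x) (fun i => pd_lap hv hpos heq i x) (inv_pos.2 (hpos x)) ?_
  have := heq x
  rw [inv_mul_le_iff₀ (hpos x)]
  linarith

lemma integral_sq_mul_hessDefect_le (hv : ContDiff ℝ 2 v) (hpos : ∀ x, 0 < v x) (hm : 0 < m)
    (heq : ∀ x, v x * lap v x = 3 / 2 * ∑ i, pd i v x ^ 2 + m)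
    {η : R3 → ℝ} (hη : ContDiff ℝ 1 η) (hc : HasCompactSupport η) :
    ∫ x, η x ^ 2 * ((v x)⁻¹ ^ 2 * hessDefect v x / √(lap v x)) ≤
      32 * ∫ x, (v x)⁻¹ * √(lap v x) * ∑ i, pd i η x ^ 2 := by
  have hl := contDiff_lap hv hpos heq
  have hlpos := lap_pos hpos hm heq
  have hp : ContDiff ℝ 1 fun x => √(lap v x) := hl.sqrt fun x => (hlpos x).ne'
  have hppos : ∀ x, 0 < √(lap v x) := fun x => Real.sqrt_pos.2 (hlpos x)
  have hpi : ContDiff ℝ 1 fun x => (√(lap v x))⁻¹ := hp.inv fun x => (hppos x).ne'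
  have hψ : ContDiff ℝ 1 fun x => η x ^ 2 * (√(lap v x))⁻¹ := (hη.pow 2).mul hpi
  have hη2c : HasCompactSupport fun x => η x ^ 2 :=
    hc.comp_left (g := fun t : ℝ => t ^ 2) (by norm_num)
  have hψc : HasCompactSupport fun x => η x ^ 2 * (√(lap v x))⁻¹ := hη2c.mul_right
  have hob := integral_obata hv hpos heq hψ hψc
  have hdl : ∀ i x, pd i (lap v) x = 2 * √(lap v x) * pd i (fun x => √(lap v x)) x := by
    intro i x
    rw [pd_comp i (Real.hasDerivAt_sqrt (hlpos x).ne') (hl.differentiable (by norm_num) x)]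
    have := (hppos x).ne'
    field_simp
  have hdψ : ∀ i x, pd i (fun x => η x ^ 2 * (√(lap v x))⁻¹) x =
      η x ^ 2 * (-(√(lap v x) ^ 2)⁻¹ * pd i (fun x => √(lap v x)) x) +
        (√(lap v x))⁻¹ * (2 * η x * pd i η x) := by
    intro i x
    have hd : HasDerivAt (fun t : ℝ => t ^ 2) (2 * η x) (η x) := by
      simpa using hasDerivAt_pow 2 (η x)
    rw [pd_mul i ((hη.pow 2).differentiable (by norm_num) x)
      (hpi.differentiable (by norm_num) x), pd_inv i (hp.differentiable (by norm_num) x)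
      (hppos x).ne', pd_comp i hd (hη.differentiable (by norm_num) x)]
  have hr : Continuous fun x => (v x)⁻¹ := hv.continuous.inv₀ fun x => (hpos x).ne'
  have hS := continuous_hessDefect hv
  have i1 : Integrable fun x => η x ^ 2 * ((v x)⁻¹ ^ 2 * hessDefect v x / √(lap v x)) := by
    refine integrable_of_continuous_compact ?_ hη2c.mul_right
    exact (hη.continuous.pow 2).mul (((hr.pow 2).mul hS).div hp.continuous fun x => (hppos x).ne')
  have i2 : Integrable fun x => (v x)⁻¹ * √(lap v x) * ∑ i, pd i η x ^ 2 := by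
    simp_rw [Finset.mul_sum]
    refine integrable_finsetSum _ fun i _ => integrable_of_continuous_compact ?_ ?_
    · exact (hr.mul hp.continuous).mul ((continuous_pd i hη).pow 2)
    · have : HasCompactSupport fun x => pd i η x ^ 2 :=
        (hasCompactSupport_pd i hc).comp_left (g := fun t : ℝ => t ^ 2) (by norm_num)
      exact this.mul_left
  have i3 : Integrable fun x => (v x)⁻¹ ^ 2 * (η x ^ 2 * (√(lap v x))⁻¹) * hessDefect v x +
      1 / 3 * (v x)⁻¹ * ∑ i, pd i (lap v) x * pd i (fun x => η x ^ 2 * (√(lap v x))⁻¹) x := by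
    refine Integrable.add ?_ ?_
    · exact integrable_of_continuous_compact (((hr.pow 2).mul hψ.continuous).mul hS)
        (hψc.mul_left.mul_right)
    · simp_rw [Finset.mul_sum]
      refine integrable_finsetSum _ fun i _ => integrable_of_continuous_compact ?_ ?_
      · exact (continuous_const.mul hr).mul ((continuous_pd i hl).mul (continuous_pd i hψ))
      · exact (hasCompactSupport_pd i hψc).mul_left.mul_left
  have hmono := integral_mono ((i1.const_mul (1 / 8)).sub (i2.const_mul 4)) i3 (fun x => by
    simp only [hdl, hdψ]
    refine cutoff_lower_bound (v x)⁻¹ (η x) (√(lap v x)) (hessDefect v x) (fun i => pd i η x)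
      (fun i => pd i (fun x => √(lap v x)) x) (inv_pos.2 (hpos x)) (hppos x) ?_
    have h := sum_pd_lap_sq_le hv hpos hm heq x
    simp only [hdl, mul_pow, ← Finset.mul_sum, Real.sq_sqrt (hlpos x).le] at h
    refine le_of_mul_le_mul_left ?_ (hlpos x)
    linarith)
  rw [hob] at hmono
  have e := integral_sub (i1.const_mul (1 / 8)) (i2.const_mul 4)
  rw [integral_const_mul, integral_const_mul] at e
  simp only [Pi.sub_apply] at hmono
  linarith

end Obata

/-- A family of cutoffs `η R`, equal to `1` on the ball of radius `R` and to `0` outside the ball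
of radius `2R`, obtained by scaling a fixed bump function. -/
structure CutoffFamily where
  η : ℝ → R3 → ℝ
  C : ℝ
  V : ℝ
  C_nonneg : 0 ≤ C
  V_nonneg : 0 ≤ V
  contDiff : ∀ R, ContDiff ℝ 1 (η R)
  compact : ∀ R, 0 < R → HasCompactSupport (η R)
  nonneg : ∀ R x, 0 ≤ η R x
  le_one : ∀ R x, η R x ≤ 1
  eq_one : ∀ R x, 0 < R → ‖x‖ ≤ R → η R x = 1
  eq_zero : ∀ R x, 0 < R → 2 * R ≤ ‖x‖ → η R x = 0
  abs_pd_le : ∀ R i x, 0 < R → |pd i (η R) x| ≤ C / R * η (2 * R) x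
  integral_eq : ∀ R, 0 < R → ∫ x, η R x = R ^ 3 * V

lemma exists_cutoffFamily : Nonempty CutoffFamily := by
  let χ : ContDiffBump (0 : R3) := ⟨1, 2, by norm_num, by norm_num⟩
  have hχ : ContDiff ℝ 1 χ := χ.contDiff
  obtain ⟨M, hM⟩ : ∃ M, ∀ i x, |pd i χ x| ≤ M := by
    have h : ∀ i, ∃ M, ∀ x, ‖pd i χ x‖ ≤ M := fun i =>
      (continuous_pd i hχ).bounded_above_of_compact_support
        (hasCompactSupport_pd i χ.hasCompactSupport)
    choose M hM using h
    refine ⟨∑ i, |M i|, fun i x => (hM i x).trans ((le_abs_self _).trans ?_)⟩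
    exact Finset.single_le_sum (f := fun i => |M i|) (fun i _ => abs_nonneg _) (Finset.mem_univ i)
  have hM0 : 0 ≤ M := (abs_nonneg _).trans (hM 0 0)
  have hone : ∀ (R : ℝ) (x : R3), 0 < R → ‖x‖ ≤ R → χ (R⁻¹ • x) = 1 := by
    intro R x hR hx
    refine χ.one_of_mem_closedBall ?_
    rw [mem_closedBall_zero_iff, norm_smul, norm_inv, Real.norm_of_nonneg hR.le,
      inv_mul_le_iff₀ hR]
    simpa [χ] using hx
  have hzero : ∀ (R : ℝ) (x : R3), 0 < R → 2 * R ≤ ‖x‖ → χ (R⁻¹ • x) = 0 := by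
    intro R x hR hx
    refine χ.zero_of_le_dist ?_
    rw [dist_zero_right, norm_smul, norm_inv, Real.norm_of_nonneg hR.le, le_inv_mul_iff₀ hR]
    simpa [χ, mul_comm] using hx
  have hpd : ∀ (R : ℝ) i x, pd i (fun x => χ (R⁻¹ • x)) x = R⁻¹ * pd i χ (R⁻¹ • x) := by
    intro R i x
    simp [pd, fderiv_comp_smul]
  have hcont : ∀ R : ℝ, ContDiff ℝ 1 fun x : R3 => χ (R⁻¹ • x) := fun R =>
    hχ.comp (contDiff_const_smul _)
  have hcomp : ∀ R : ℝ, 0 < R → HasCompactSupport fun x : R3 => χ (R⁻¹ • x) := fun R hR =>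
    χ.hasCompactSupport.comp_smul (inv_ne_zero hR.ne')
  refine ⟨⟨fun R x => χ (R⁻¹ • x), M, ∫ x, χ x, hM0, integral_nonneg fun x => χ.nonneg, hcont,
    hcomp, fun R x => χ.nonneg, fun R x => χ.le_one, hone, hzero, ?_, ?_⟩⟩
  · intro R i x hR
    by_cases hx : x ∈ tsupport fun x => χ (R⁻¹ • x)
    · have hle : ‖x‖ ≤ 2 * R := by
        have hsub : tsupport (fun x => χ (R⁻¹ • x)) ⊆ Metric.closedBall 0 (2 * R) := by
          refine closure_minimal (fun y hy => ?_) Metric.isClosed_closedBall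
          rw [mem_closedBall_zero_iff]
          by_contra! h
          exact hy (hzero R y hR h.le)
        simpa using hsub hx
      rw [hone (2 * R) x (by positivity) hle, hpd, abs_mul, abs_inv, abs_of_pos hR, mul_one,
        div_eq_inv_mul]
      exact mul_le_mul_of_nonneg_left (hM _ _) (by positivity)
    · rw [pd_eq_zero_of_notMem_tsupport i hx, abs_zero]
      exact mul_nonneg (by positivity) χ.nonneg
  · intro R hR
    rw [Measure.integral_comp_inv_smul_of_nonneg _ _ hR.le]
    simp

section Solution

variable {u : R3 → ℝ} {c : ℝ}

lemma abs_le_scaled {T : ℝ} (hT : 0 < T) (s : ℝ) : |s| ≤ T ^ 3 * s ^ 2 + (T ^ 3)⁻¹ := by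
  have hT3 : 0 < T ^ 3 := by positivity
  rw [← sq_abs s]
  have h : T ^ 3 * |s| ^ 2 + (T ^ 3)⁻¹ - |s| =
      (T ^ 3)⁻¹ * ((T ^ 3 * |s| - 1 / 2) ^ 2 + 3 / 4) := by
    field_simp
    ring
  have : 0 ≤ (T ^ 3)⁻¹ * ((T ^ 3 * |s| - 1 / 2) ^ 2 + 3 / 4) := by positivity
  linarith

lemma cube_le_scaled {T s : ℝ} (hT : 0 < T) (hs : 0 < s) :
    s ^ 3 ≤ T ^ 2 * s ^ 5 + (T ^ 3)⁻¹ := by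
  rcases le_total 1 (T * s) with h | h
  · have h1 : 1 ≤ (T * s) ^ 2 := one_le_pow₀ h
    have h2 : (0 : ℝ) ≤ (T ^ 3)⁻¹ := by positivity
    have h3 : s ^ 3 * 1 ≤ s ^ 3 * (T * s) ^ 2 := by gcongr
    nlinarith
  · have h1 : (T * s) ^ 3 ≤ 1 := pow_le_one₀ (by positivity) h
    have h2 : s ^ 3 ≤ (T ^ 3)⁻¹ := by
      rw [le_inv_comm₀ (by positivity) (by positivity), le_inv_comm₀ (by positivity) (by positivity)]
      rw [← one_div, le_div_iff₀ (by positivity)]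
      linarith [mul_pow T s 3]
    have : 0 ≤ T ^ 2 * s ^ 5 := by positivity
    linarith

lemma integral_pow_five_mul_cutoff_le (F : CutoffFamily) (hu : ContDiff ℝ 2 u) (hc : 0 < c)
    (heq : ∀ x, -(c * lap u x) = u x ^ 5)
    (hfin : Integrable fun x => ∑ i, pd i u x ^ 2) {T : ℝ} (hT : 0 < T) :
    ∫ x, u x ^ 5 * F.η (2 * T ^ 2) x ≤
      c * F.C / 2 * ((∫ x, ∑ i, pd i u x ^ 2) + 192 * F.V) * T := by
  have hu1 : ∀ i, ContDiff ℝ 1 (pd i u) := fun i => contDiff_pd i hu (by norm_num)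
  set R := 2 * T ^ 2 with hR
  have hR0 : 0 < R := by positivity
  have hη := F.contDiff R
  have hcη := F.compact R hR0
  have h2 := integrable_of_continuous_compact (F.contDiff (2 * R)).continuous
    (F.compact (2 * R) (by positivity))
  have hi : ∀ i, Integrable fun x => pd i u x * pd i (F.η R) x := fun i =>
    integrable_of_continuous_compact ((hu1 i).continuous.mul (continuous_pd i hη))
      (hasCompactSupport_pd i hcη).mul_left
  have hi' : ∀ i, Integrable fun x => pd i (pd i u) x * F.η R x := fun i =>
    integrable_of_continuous_compact ((continuous_pd i (hu1 i)).mul hη.continuous) hcη.mul_left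
  have e1 : ∫ x, u x ^ 5 * F.η R x = c * ∫ x, ∑ i, pd i u x * pd i (F.η R) x := by
    rw [integral_finsetSum _ fun i _ => hi i]
    simp_rw [integral_mul_pd _ (hu1 _) hη hcη, Finset.sum_neg_distrib]
    rw [← integral_finsetSum _ fun i _ => hi' i, mul_neg, ← integral_const_mul, ← integral_neg]
    refine integral_congr_ae (.of_forall fun x => ?_)
    simp only [← heq x, lap_eq_sum_pd, ← Finset.sum_mul]
    ring
  rw [e1]
  have hb : ∫ x, ∑ i, pd i u x * pd i (F.η R) x ≤
      ∫ x, F.C / R * (T ^ 3 * (∑ i, pd i u x ^ 2) + 3 * (T ^ 3)⁻¹ * F.η (2 * R) x) := by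
    refine integral_mono (integrable_finsetSum _ fun i _ => hi i)
      (((hfin.const_mul _).add (h2.const_mul _)).const_mul _) fun x => ?_
    have h : ∀ i, pd i u x * pd i (F.η R) x ≤
        F.C / R * (T ^ 3 * pd i u x ^ 2 + (T ^ 3)⁻¹ * F.η (2 * R) x) := by
      intro i
      have hCR : 0 ≤ F.C / R := div_nonneg F.C_nonneg hR0.le
      have h0 := F.nonneg (2 * R) x
      calc _ ≤ |pd i u x| * |pd i (F.η R) x| := by rw [← abs_mul]; exact le_abs_self _
        _ ≤ (T ^ 3 * pd i u x ^ 2 + (T ^ 3)⁻¹) * (F.C / R * F.η (2 * R) x) := by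
          gcongr
          · exact abs_le_scaled hT _
          · exact F.abs_pd_le R i x hR0
        _ = F.C / R * (T ^ 3 * pd i u x ^ 2 * F.η (2 * R) x + (T ^ 3)⁻¹ * F.η (2 * R) x) := by ring
        _ ≤ _ := mul_le_mul_of_nonneg_left (add_le_add_left
          (mul_le_of_le_one_right (by positivity) (F.le_one _ _)) _) hCR
    refine (Finset.sum_le_sum fun i _ => h i).trans (le_of_eq ?_)
    simp only [Fin.sum_univ_three]
    ring
  rw [integral_const_mul, integral_add (hfin.const_mul _) (h2.const_mul _), integral_const_mul,
    integral_const_mul, F.integral_eq _ (by positivity)] at hb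
  refine (mul_le_mul_of_nonneg_left hb hc.le).trans (le_of_eq ?_)
  rw [hR]
  field_simp
  ring

lemma contDiff_inv_sq (hu : ContDiff ℝ 2 u) (hpos : ∀ x, 0 < u x) :
    ContDiff ℝ 2 fun x => (u x ^ 2)⁻¹ :=
  (hu.pow 2).inv fun x => pow_ne_zero 2 (hpos x).ne'

lemma pd_inv_sq (hu : ContDiff ℝ 2 u) (hpos : ∀ x, 0 < u x) (i : Fin 3) (x : R3) :
    pd i (fun x => (u x ^ 2)⁻¹) x = -2 * (u x ^ 3)⁻¹ * pd i u x := by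
  have hd : HasDerivAt (fun t : ℝ => (t ^ 2)⁻¹) (-2 * (u x ^ 3)⁻¹) (u x) := by
    have := (hpos x).ne'
    refine ((hasDerivAt_pow 2 (u x)).fun_inv (by positivity)).congr_deriv ?_
    norm_num
    field_simp
  exact pd_comp i hd (hu.differentiable (by norm_num) x)

lemma inv_sq_mul_lap (hu : ContDiff ℝ 2 u) (hpos : ∀ x, 0 < u x) (hc : 0 < c)
    (heq : ∀ x, -(c * lap u x) = u x ^ 5) (x : R3) :
    (u x ^ 2)⁻¹ * lap (fun x => (u x ^ 2)⁻¹) x =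
      3 / 2 * ∑ i, pd i (fun x => (u x ^ 2)⁻¹) x ^ 2 + 2 / c := by
  have hne := (hpos x).ne'
  have hl : ∀ i, pd i (pd i fun x => (u x ^ 2)⁻¹) x =
      6 * (u x ^ 4)⁻¹ * pd i u x ^ 2 - 2 * (u x ^ 3)⁻¹ * pd i (pd i u) x := by
    intro i
    rw [show pd i (fun x => (u x ^ 2)⁻¹) = fun x => -2 * (u x ^ 3)⁻¹ * pd i u x from
      funext fun x => pd_inv_sq hu hpos i x]
    have hd : HasDerivAt (fun t : ℝ => -2 * (t ^ 3)⁻¹) (6 * (u x ^ 4)⁻¹) (u x) := by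
      refine (((hasDerivAt_pow 3 (u x)).fun_inv (by positivity)).const_mul (-2)).congr_deriv ?_
      norm_num
      field_simp
      norm_num
    have hud := hu.differentiable (by norm_num) x
    have hdd : DifferentiableAt ℝ (fun x => -2 * (u x ^ 3)⁻¹) x :=
      hd.differentiableAt.comp x hud
    rw [pd_mul i hdd ((contDiff_pd (m := 1) i hu (by norm_num)).differentiable (by norm_num) x),
      pd_comp i hd hud]
    ring
  have h1 : lap u x = -(u x ^ 5) / c := by rw [← heq x]; field_simp
  rw [lap_eq_sum_pd] at h1 ⊢
  simp only [hl, pd_inv_sq hu hpos, Finset.sum_sub_distrib, ← Finset.mul_sum, h1, mul_pow]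
  field_simp
  ring

lemma sq_mul_sqrt_lap_le (hu : ContDiff ℝ 2 u) (hpos : ∀ x, 0 < u x) (hc : 0 < c)
    (heq : ∀ x, -(c * lap u x) = u x ^ 5) (x : R3) :
    (u x ^ 2) * √(lap (fun x => (u x ^ 2)⁻¹) x) ≤
      √(2 / c + 6) * (u x ^ 3 + ∑ i, |pd i u x|) := by
  have hx := hpos x
  have hne := hx.ne'
  have h := inv_sq_mul_lap hu hpos hc heq x
  set g := ∑ i, |pd i u x| with hg
  have hg0 : 0 ≤ g := by positivity
  have hgs : ∑ i, pd i u x ^ 2 ≤ g ^ 2 := by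
    simpa only [sq_abs] using
      Finset.sum_sq_le_sq_sum_of_nonneg (s := Finset.univ) (f := fun i => |pd i u x|)
        (fun i _ => abs_nonneg _)
  have hP : u x ^ 4 * lap (fun x => (u x ^ 2)⁻¹) x =
      2 / c * u x ^ 6 + 6 * ∑ i, pd i u x ^ 2 := by
    simp only [pd_inv_sq hu hpos, mul_pow, ← Finset.mul_sum] at h
    rw [inv_mul_eq_iff_eq_mul₀ (by positivity)] at h
    rw [h]
    field_simp
    ring
  refine le_of_sq_le_sq ?_ (by positivity)
  have hlp : 0 < lap (fun x => (u x ^ 2)⁻¹) x := lap_pos (m := 2 / c)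
    (fun x => by have := hpos x; positivity) (by positivity) (inv_sq_mul_lap hu hpos hc heq) x
  rw [mul_pow, mul_pow, Real.sq_sqrt hlp.le, Real.sq_sqrt (by positivity)]
  have : (u x ^ 2) ^ 2 * lap (fun x => (u x ^ 2)⁻¹) x = 2 / c * u x ^ 6 + 6 * ∑ i, pd i u x ^ 2 := by
    rw [← hP]; ring
  rw [this]
  have hm : 0 < 2 / c := by positivity
  have h1 : 2 / c * u x ^ 6 ≤ (2 / c + 6) * u x ^ 6 := by gcongr; linarith
  have h2 : 6 * ∑ i, pd i u x ^ 2 ≤ (2 / c + 6) * g ^ 2 := by gcongr; linarith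
  have h3 : 0 ≤ (2 / c + 6) * (2 * u x ^ 3 * g) := by positivity
  nlinarith

lemma integral_cutoff_weight_le (F : CutoffFamily) (hu : ContDiff ℝ 2 u) (hpos : ∀ x, 0 < u x)
    (hc : 0 < c) (heq : ∀ x, -(c * lap u x) = u x ^ 5)
    (hfin : Integrable fun x => ∑ i, pd i u x ^ 2) :
    ∃ A, ∀ T, 0 < T → ∫ x, ((u x ^ 2)⁻¹)⁻¹ * √(lap (fun x => (u x ^ 2)⁻¹) x) *
      ∑ i, pd i (F.η (T ^ 2)) x ^ 2 ≤ A / T := by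
  set K := √(2 / c + 6)
  set D := ∫ x, ∑ i, pd i u x ^ 2
  set B := c * F.C / 2 * (D + 192 * F.V)
  refine ⟨3 * K * F.C ^ 2 * (B + D + 32 * F.V), fun T hT => ?_⟩
  set R := T ^ 2 with hR
  have hR0 : 0 < R := by positivity
  have h2 := integrable_of_continuous_compact (F.contDiff (2 * R)).continuous
    (F.compact (2 * R) (by positivity))
  have h5 : Integrable fun x => u x ^ 5 * F.η (2 * R) x :=
    integrable_of_continuous_compact ((hu.continuous.pow 5).mul (F.contDiff _).continuous)
      (F.compact (2 * R) (by positivity)).mul_left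
  have hb : ∀ x, ((u x ^ 2)⁻¹)⁻¹ * √(lap (fun x => (u x ^ 2)⁻¹) x) *
      ∑ i, pd i (F.η R) x ^ 2 ≤ 3 * K * (F.C / R) ^ 2 *
        (T ^ 2 * (u x ^ 5 * F.η (2 * R) x) + T ^ 3 * (∑ i, pd i u x ^ 2) +
          4 * (T ^ 3)⁻¹ * F.η (2 * R) x) := by
    intro x
    have h0 := F.nonneg (2 * R) x
    have h1 := F.le_one (2 * R) x
    have hx := hpos x
    rw [inv_inv]
    have hη : ∑ i, pd i (F.η R) x ^ 2 ≤ 3 * ((F.C / R) ^ 2 * F.η (2 * R) x) := by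
      have : ∀ i ∈ Finset.univ, pd i (F.η R) x ^ 2 ≤ (F.C / R) ^ 2 * F.η (2 * R) x := by
        intro i _
        rw [← sq_abs]
        refine (pow_le_pow_left₀ (abs_nonneg _) (F.abs_pd_le R i x hR0) 2).trans ?_
        rw [mul_pow]
        gcongr
        exact pow_le_of_le_one h0 h1 two_ne_zero
      simpa using Finset.sum_le_sum this
    have hg : ∑ i, |pd i u x| ≤ T ^ 3 * (∑ i, pd i u x ^ 2) + 3 * (T ^ 3)⁻¹ := by
      refine (Finset.sum_le_sum fun i _ => abs_le_scaled hT (pd i u x)).trans (le_of_eq ?_)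
      simp [Finset.sum_add_distrib, Finset.mul_sum]
    calc _ ≤ (K * (u x ^ 3 + ∑ i, |pd i u x|)) * (3 * ((F.C / R) ^ 2 * F.η (2 * R) x)) := by
          exact mul_le_mul (sq_mul_sqrt_lap_le hu hpos hc heq x) hη (by positivity)
            (by positivity)
      _ ≤ (K * ((T ^ 2 * u x ^ 5 + (T ^ 3)⁻¹) +
            (T ^ 3 * (∑ i, pd i u x ^ 2) + 3 * (T ^ 3)⁻¹))) *
            (3 * ((F.C / R) ^ 2 * F.η (2 * R) x)) := by
          gcongr
          exact cube_le_scaled hT hx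
      _ = 3 * K * (F.C / R) ^ 2 * (T ^ 2 * (u x ^ 5 * F.η (2 * R) x) +
            (T ^ 3 * (∑ i, pd i u x ^ 2)) * F.η (2 * R) x +
            4 * (T ^ 3)⁻¹ * F.η (2 * R) x) := by ring
      _ ≤ _ := by
          refine mul_le_mul_of_nonneg_left ?_ (by positivity)
          have : T ^ 3 * (∑ i, pd i u x ^ 2) * F.η (2 * R) x ≤ T ^ 3 * ∑ i, pd i u x ^ 2 :=
            mul_le_of_le_one_right (by positivity) h1
          linarith
  refine (integral_mono_of_nonneg (.of_forall fun x => ?_) ?_ (.of_forall hb)).trans ?_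
  · have := hpos x
    positivity
  · exact (((h5.const_mul _).add (hfin.const_mul _)).add (h2.const_mul _)).const_mul _
  · have h5D : Integrable fun x => T ^ 2 * (u x ^ 5 * F.η (2 * R) x) +
        T ^ 3 * ∑ i, pd i u x ^ 2 := (h5.const_mul _).add (hfin.const_mul _)
    rw [integral_const_mul, integral_add h5D (h2.const_mul _),
      integral_add (h5.const_mul _) (hfin.const_mul _), integral_const_mul, integral_const_mul,
      integral_const_mul, F.integral_eq _ (by positivity)]
    have hB := integral_pow_five_mul_cutoff_le F hu hc heq hfin hT
    calc _ ≤ 3 * K * (F.C / R) ^ 2 * (T ^ 2 * (B * T) + T ^ 3 * D +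
          4 * (T ^ 3)⁻¹ * ((2 * R) ^ 3 * F.V)) := by gcongr
      _ = _ := by
        rw [hR]
        field_simp
        ring

theorem hessDefect_inv_sq_eq_zero (hu : ContDiff ℝ 2 u) (hpos : ∀ x, 0 < u x)
    (hc : 0 < c) (heq : ∀ x, -(c * lap u x) = u x ^ 5)
    (hfin : Integrable fun x => ∑ i, pd i u x ^ 2) (x₀ : R3) :
    hessDefect (fun x => (u x ^ 2)⁻¹) x₀ = 0 := by
  obtain ⟨F⟩ := exists_cutoffFamily
  obtain ⟨A, hA⟩ := integral_cutoff_weight_le F hu hpos hc heq hfin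
  set v : R3 → ℝ := fun x => (u x ^ 2)⁻¹ with hv_def
  have hv : ContDiff ℝ 2 v := contDiff_inv_sq hu hpos
  have hvpos : ∀ x, 0 < v x := fun x => by have := hpos x; simp only [v]; positivity
  have hm : 0 < 2 / c := by positivity
  have hveq := inv_sq_mul_lap hu hpos hc heq
  have hlpos := lap_pos hvpos hm hveq
  have hspos : ∀ x, 0 < √(lap v x) := fun x => Real.sqrt_pos.2 (hlpos x)
  set Y : R3 → ℝ := fun x => (v x)⁻¹ ^ 2 * hessDefect v x / √(lap v x) with hY
  have hYc : Continuous Y :=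
    (((hv.continuous.inv₀ fun x => (hvpos x).ne').pow 2).mul (continuous_hessDefect hv)).div
      (contDiff_lap hv hvpos hveq).continuous.sqrt fun x => (hspos x).ne'
  have hY0 : ∀ x, 0 ≤ Y x := fun x =>
    div_nonneg (mul_nonneg (sq_nonneg _) (hessDefect_nonneg x)) (hspos x).le
  suffices hYx : Y x₀ = 0 by
    have h1 := (hspos x₀).ne'
    have h2 := (hvpos x₀).ne'
    simpa [hY, h1, h2] using hYx
  by_contra hne
  set R := ‖x₀‖ + 1 with hR
  have hR0 : 0 < R := by positivity
  have hint : ∀ S, 0 < S → Integrable fun x => F.η S x ^ 2 * Y x := fun S hS =>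
    integrable_of_continuous_compact (((F.contDiff S).continuous.pow 2).mul hYc)
      (((F.compact S hS).comp_left (g := fun t : ℝ => t ^ 2) (by norm_num)).mul_right)
  have hpos' : 0 < ∫ x, F.η R x ^ 2 * Y x := by
    refine Continuous.integral_pos_of_hasCompactSupport_nonneg_nonzero (x := x₀)
      (((F.contDiff R).continuous.pow 2).mul hYc)
      (((F.compact R hR0).comp_left (g := fun t : ℝ => t ^ 2) (by norm_num)).mul_right)
      (fun x => mul_nonneg (sq_nonneg _) (hY0 x)) ?_
    rw [F.eq_one R x₀ hR0 (by linarith)]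
    simpa using hne
  set δ := ∫ x, F.η R x ^ 2 * Y x
  have hle : ∀ T, 0 < T → 2 * R ≤ T ^ 2 → δ ≤ 32 * (A / T) := by
    intro T hT hTR
    have hT2 : 0 < T ^ 2 := by positivity
    refine le_trans ?_ ((integral_sq_mul_hessDefect_le hv hvpos hm hveq (F.contDiff (T ^ 2))
      (F.compact _ hT2)).trans (mul_le_mul_of_nonneg_left (hA T hT) (by norm_num)))
    refine integral_mono (hint R hR0) (hint _ hT2) fun x => ?_
    refine mul_le_mul_of_nonneg_right ?_ (hY0 x)
    rcases le_total (2 * R) ‖x‖ with h | h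
    · rw [F.eq_zero R x hR0 h, zero_pow two_ne_zero]
      exact sq_nonneg _
    · rw [F.eq_one (T ^ 2) x hT2 (h.trans hTR)]
      exact pow_le_pow_left₀ (F.nonneg _ _) (F.le_one _ _) 2
  have hlim : Filter.Tendsto (fun T : ℝ => 32 * (A / T)) Filter.atTop (nhds 0) := by
    simpa using (Filter.Tendsto.const_div_atTop Filter.tendsto_id A).const_mul 32
  have hev : ∀ᶠ T : ℝ in Filter.atTop, δ ≤ 32 * (A / T) := by
    filter_upwards [Filter.eventually_ge_atTop (2 * R), Filter.eventually_ge_atTop 1] with T h1 h2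
    exact hle T (by linarith) (by nlinarith)
  exact hpos'.not_ge (ge_of_tendsto hlim hev)

end Solution

section Classification

lemma pd_norm_sub_sq (a : R3) (i : Fin 3) (x : R3) :
    pd i (fun y => ‖y - a‖ ^ 2) x = 2 * (x i - a i) := by
  have h : HasFDerivAt (fun y : R3 => ‖y - a‖ ^ 2) _ x :=
    ((hasFDerivAt_id x).sub_const a).norm_sq
  rw [pd, h.fderiv]
  simp [EuclideanSpace.inner_single_right]

/-- A function whose Hessian has no trace-free part and which satisfies the equation for
`u⁻²` is a paraboloid. -/
lemma exists_paraboloid {v : R3 → ℝ} {m : ℝ} (hv : ContDiff ℝ 2 v) (hpos : ∀ x, 0 < v x)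
    (hm : 0 < m) (heq : ∀ x, v x * lap v x = 3 / 2 * ∑ i, pd i v x ^ 2 + m)
    (hS : ∀ x, hessDefect v x = 0) :
    ∃ (a : R3) (l A : ℝ), 0 < l ∧ 0 < A ∧ 6 * (l * A) = m ∧ ∀ x, v x = A + l * ‖x - a‖ ^ 2 := by
  have hl := contDiff_lap hv hpos heq
  have h1 : ∀ i, Differentiable ℝ (pd i v) :=
    fun i => (contDiff_pd (m := 1) i hv (by norm_num)).differentiable (by norm_num)
  have hdl : ∀ i x, pd i (lap v) x = 0 := by
    intro i x
    have h := sum_pd_lap_sq_le hv hpos hm heq x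
    rw [hS, mul_zero] at h
    have h0 := Finset.single_le_sum (f := fun i => pd i (lap v) x ^ 2)
      (fun i _ => sq_nonneg _) (Finset.mem_univ i)
    exact pow_eq_zero_iff two_ne_zero |>.1 (le_antisymm (h0.trans h) (sq_nonneg _))
  set l := lap v 0 / 6 with hldef
  have hlpos : 0 < l := by have := lap_pos hpos hm heq 0; positivity
  have hlap : ∀ x, lap v x = 6 * l := fun x => by
    rw [eq_const_of_pd_eq_zero (hl.differentiable (by norm_num)) hdl x 0, hldef]; ring
  have hH : ∀ x i j, pd i (pd j v) x = if i = j then 2 * l else 0 := by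
    intro x i j
    have h := hS x
    rw [hessDefect, ← sum_sq_traceless _ _ (lap_eq_sum_pd v x)] at h
    rw [Finset.sum_eq_zero_iff_of_nonneg fun i _ => Finset.sum_nonneg fun j _ => sq_nonneg _] at h
    have h' := (Finset.sum_eq_zero_iff_of_nonneg fun j _ => sq_nonneg _).1
      (h i (Finset.mem_univ i)) j (Finset.mem_univ j)
    rw [sq_eq_zero_iff, sub_eq_zero, hlap] at h'
    rw [h']
    split_ifs <;> ring
  have hcoord : ∀ j, Differentiable ℝ fun y : R3 => y j := fun j => by fun_prop
  have hlin : ∀ j x, pd j v x = 2 * l * x j + pd j v 0 := by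
    intro j x
    have h := eq_const_of_pd_eq_zero (f := fun y => pd j v y - 2 * l * y j)
      ((h1 j).sub ((hcoord j).const_mul _)) (fun i y => by
        rw [pd_sub i (h1 j y) ((hcoord j y).const_mul _), pd_const_mul i _ (hcoord j y), pd_coord,
          hH]
        split_ifs <;> ring) x 0
    simp at h
    linarith
  let a : R3 := WithLp.toLp 2 fun j => -(pd j v 0 / (2 * l))
  have ha : ∀ j, a j = -(pd j v 0 / (2 * l)) := fun j => rfl
  have hgrad : ∀ j x, pd j v x = 2 * l * (x j - a j) := by
    intro j x
    rw [hlin, ha]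
    field_simp
    ring
  have hnd : Differentiable ℝ fun x : R3 => ‖x - a‖ ^ 2 :=
    (differentiable_id.sub_const a).norm_sq ℝ
  have hv0 : ∀ x, v x = v a + l * ‖x - a‖ ^ 2 := by
    intro x
    have h := eq_const_of_pd_eq_zero (f := fun y => v y - l * ‖y - a‖ ^ 2)
      ((hv.differentiable (by norm_num)).sub (hnd.const_mul _)) (fun i y => by
        rw [pd_sub i (hv.differentiable (by norm_num) y) ((hnd y).const_mul _),
          pd_const_mul i _ (hnd y), pd_norm_sub_sq, hgrad]
        ring) x a
    simp at h
    linarith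
  refine ⟨a, l, v a, hlpos, hpos a, ?_, hv0⟩
  have h := heq a
  simp only [hlap, hgrad, sub_self, mul_zero] at h
  simp at h
  linarith

end Classification

section Energy

lemma norm_gradient_Qb_sq (x : R3) :
    ‖gradient Qb x‖ ^ 2 = √3 * (‖x‖ ^ 2 / (1 + ‖x‖ ^ 2) ^ 3) := by
  have hpos : 0 < 1 + ‖x‖ ^ 2 := by positivity
  have hpd : ∀ i, pd i Qb x =
      (3 : ℝ) ^ ((1 : ℝ) / 4) * ((-(1 : ℝ) / 2) * (1 + ‖x‖ ^ 2) ^ (-(1 : ℝ) / 2 - 1)) * (2 * x i) := by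
    intro i
    have hd : HasDerivAt (fun t : ℝ => (3 : ℝ) ^ ((1 : ℝ) / 4) * (1 + t) ^ (-(1 : ℝ) / 2))
        ((3 : ℝ) ^ ((1 : ℝ) / 4) * ((-(1 : ℝ) / 2) * (1 + ‖x‖ ^ 2) ^ (-(1 : ℝ) / 2 - 1)))
        (‖x‖ ^ 2) := by
      refine HasDerivAt.const_mul _ ?_
      have := ((hasDerivAt_id (‖x‖ ^ 2)).const_add 1).rpow_const (p := -(1 : ℝ) / 2)
        (Or.inl hpos.ne')
      exact this.congr_deriv (by simp)
    have hn : DifferentiableAt ℝ (fun x : R3 => ‖x‖ ^ 2) x := differentiableAt_id.norm_sq ℝ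
    have hnorm := pd_norm_sub_sq 0 i x
    simp only [sub_zero, PiLp.zero_apply] at hnorm
    rw [← hnorm]
    exact pd_comp i hd hn
  have h3 : ((3 : ℝ) ^ ((1 : ℝ) / 4)) ^ 2 = √3 := by
    rw [Real.sqrt_eq_rpow, ← Real.rpow_natCast, ← Real.rpow_mul (by norm_num)]
    norm_num
  have hq : ∀ y : ℝ, 0 < y → (y ^ (-(1 : ℝ) / 2 - 1)) ^ 2 = (y ^ 3)⁻¹ := by
    intro y hy
    rw [← Real.rpow_natCast, ← Real.rpow_mul hy.le, ← Real.rpow_natCast, ← Real.rpow_neg hy.le]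
    norm_num
  rw [norm_gradient_sq]
  simp only [hpd, mul_pow, h3, hq _ hpos, ← Finset.mul_sum, ← EuclideanSpace.real_norm_sq_eq]
  field_simp

/-- The Dirichlet energy of a function `u` such that `u⁻²` is a paraboloid. -/
lemma integral_gradient_sq_of_paraboloid {u : R3 → ℝ} (hu : ContDiff ℝ 2 u) (hpos : ∀ x, 0 < u x)
    {a : R3} {l A c : ℝ} (hl : 0 < l) (hA : 0 < A) (hc : 0 < c) (hlA : 6 * (l * A) = 2 / c)
    (h : ∀ x, (u x ^ 2)⁻¹ = A + l * ‖x - a‖ ^ 2) :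
    ∫ x, ‖gradient u x‖ ^ 2 = √c * ∫ x, ‖gradient Qb x‖ ^ 2 := by
  have hgrad : ∀ x, ‖gradient u x‖ ^ 2 =
      l ^ 2 * (‖x - a‖ ^ 2 / (A + l * ‖x - a‖ ^ 2) ^ 3) := by
    intro x
    have hx := hpos x
    have hnd : DifferentiableAt ℝ (fun x : R3 => ‖x - a‖ ^ 2) x :=
      (differentiableAt_id.sub_const a).norm_sq ℝ
    have hpd : ∀ i, pd i u x ^ 2 = l ^ 2 * (x i - a i) ^ 2 * u x ^ 6 := by
      intro i
      have h1 := pd_inv_sq hu hpos i x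
      have hd : HasDerivAt (fun t : ℝ => A + l * t) l (‖x - a‖ ^ 2) := by
        simpa using ((hasDerivAt_id (‖x - a‖ ^ 2)).const_mul l).const_add A
      rw [funext h, pd_comp i hd hnd, pd_norm_sub_sq] at h1
      have h2 : pd i u x = -(l * (x i - a i) * u x ^ 3) := by
        field_simp at h1
        linarith
      rw [h2]
      ring
    rw [norm_gradient_sq]
    simp only [hpd, ← Finset.mul_sum, ← Finset.sum_mul]
    have hn : ‖x - a‖ ^ 2 = ∑ i, (x i - a i) ^ 2 := by
      rw [EuclideanSpace.real_norm_sq_eq]; rfl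
    rw [← h, hn]
    field_simp
  simp_rw [hgrad, norm_gradient_Qb_sq]
  rw [integral_const_mul, integral_const_mul]
  set s := √(A / l) with hs
  have hs0 : 0 < s := Real.sqrt_pos.2 (by positivity)
  have hs2 : s ^ 2 = A / l := Real.sq_sqrt (by positivity)
  have hsub : ∫ x : R3, ‖x - a‖ ^ 2 / (A + l * ‖x - a‖ ^ 2) ^ 3 =
      s ^ 5 / A ^ 3 * ∫ x : R3, ‖x‖ ^ 2 / (1 + ‖x‖ ^ 2) ^ 3 := by
    rw [integral_sub_right_eq_self (fun x : R3 => ‖x‖ ^ 2 / (A + l * ‖x‖ ^ 2) ^ 3) a]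
    have hcs := Measure.integral_comp_smul_of_nonneg (volume : Measure R3)
      (fun x : R3 => ‖x‖ ^ 2 / (A + l * ‖x‖ ^ 2) ^ 3) s (hR := hs0.le)
    have hpt : ∀ x : R3, ‖s • x‖ ^ 2 / (A + l * ‖s • x‖ ^ 2) ^ 3 =
        s ^ 2 / A ^ 3 * (‖x‖ ^ 2 / (1 + ‖x‖ ^ 2) ^ 3) := by
      intro x
      rw [norm_smul, mul_pow, Real.norm_of_nonneg hs0.le, hs2]
      have : 0 < 1 + ‖x‖ ^ 2 := by positivity
      have e : A + l * (A / l * ‖x‖ ^ 2) = A * (1 + ‖x‖ ^ 2) := by field_simp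
      rw [e]
      field_simp
    simp_rw [hpt] at hcs
    rw [integral_const_mul, finrank_euclideanSpace_fin, smul_eq_mul,
      eq_inv_mul_iff_mul_eq₀ (by positivity)] at hcs
    rw [← hcs]
    ring
  rw [hsub, ← mul_assoc, ← mul_assoc]
  congr 1
  refine (pow_left_inj₀ (by positivity) (by positivity) two_ne_zero).1 ?_
  rw [mul_pow √c, Real.sq_sqrt hc.le, Real.sq_sqrt (by norm_num)]
  have hc' : c = 1 / (3 * (l * A)) := by
    field_simp at hlA ⊢
    linarith
  have : (l ^ 2 * (s ^ 5 / A ^ 3)) ^ 2 = l ^ 4 * (s ^ 2) ^ 5 / A ^ 6 := by ring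
  rw [this, hs2, hc']
  field_simp

end Energy

/-- for any positive finite-energy `C²` solution `u` of the Kirchhoff equation
`-(a + b∫|∇u|²)Δu = u⁵` on `ℝ³`, the constant `c = a + b∫|∇u|²` depends only on `a, b`:
namely `√c = (bk + √(b²k² + 4a))/2`, where `k = ∫|∇Q|²`. -/
theorem kirchhoff_constant_independent_of_solution (a b : ℝ) (ha : 0 < a) (hb : 0 < b)
    (u : R3 → ℝ) (hpos : ∀ x, 0 < u x) (hreg : ContDiff ℝ 2 u)
    (hfin : Integrable (fun x : R3 => ‖gradient u x‖ ^ 2))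
    (heq : ∀ x, -((a + b * ∫ y : R3, ‖gradient u y‖ ^ 2) * lap u x) = u x ^ 5)
    (k : ℝ) (hk : k = ∫ x : R3, ‖gradient Qb x‖ ^ 2)
    (c : ℝ) (hc : c = a + b * ∫ y : R3, ‖gradient u y‖ ^ 2) :
    Real.sqrt c = (b * k + Real.sqrt (b ^ 2 * k ^ 2 + 4 * a)) / 2 := by
  have hD : 0 ≤ ∫ y : R3, ‖gradient u y‖ ^ 2 := integral_nonneg fun y => sq_nonneg _
  have hk0 : 0 ≤ k := hk ▸ integral_nonneg fun y => sq_nonneg _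
  have hc0 : 0 < c := by rw [hc]; positivity
  have heq' : ∀ x, -(c * lap u x) = u x ^ 5 := fun x => hc ▸ heq x
  have hfin' : Integrable fun x => ∑ i, pd i u x ^ 2 := by simpa only [norm_gradient_sq] using hfin
  obtain ⟨p, l, A, hl, hA, hlA, hv⟩ := exists_paraboloid (contDiff_inv_sq hreg hpos)
    (fun x => inv_pos.2 (pow_pos (hpos x) 2)) (by positivity : 0 < 2 / c)
    (inv_sq_mul_lap hreg hpos hc0 heq') (hessDefect_inv_sq_eq_zero hreg hpos hc0 heq' hfin')
  have hE := integral_gradient_sq_of_paraboloid hreg hpos hl hA hc0 hlA hv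
  rw [← hk] at hE
  have hquad : √c ^ 2 = a + b * (√c * k) := by rw [Real.sq_sqrt hc0.le, ← hE, ← hc]
  have hsc : 0 < √c := Real.sqrt_pos.2 hc0
  have hge : 0 ≤ 2 * √c - b * k := by
    refine nonneg_of_mul_nonneg_right (a := √c) ?_ hsc
    nlinarith
  have hsq : √(b ^ 2 * k ^ 2 + 4 * a) = 2 * √c - b * k := by
    rw [← Real.sqrt_sq hge]
    congr 1
    linear_combination -4 * hquad
  rw [hsq]
  ring
end
end
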